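/- For every δ > 0 there exists τ > 0 such that for every ν > 0 and every ε > 0 there exists n₀ ∈ ℕ such that the following holds for every even n ≥ n₀, every integer d ≥ δn, and every positive integer r ≤ n^{1/50}: if G is a d-regular robust (ν,τ)-expander on n vertices and M₁, …, M_r are independent uniformly random perfect matchings of G, then the probability that M₁, …, M_r are pairwise edge-disjoint is between (1−ε)·e^{−(n/(2d))·binom(r,2)} and (1+ε)·e^{−(n/(2d))·binom(r,2)}. -/

import Mathlib

open Finset

namespace RPM

/-- The `ν`-robust neighbourhood of a vertex set `S` in a graph `G` on `n` vertices:
all vertices having at least `ν * n` neighbours in `S`. -/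
def RN {V : Type*} [Fintype V] (G : SimpleGraph V) (ν : ℝ) (S : Set V) : Set V :=
  {v : V | ν * (Fintype.card V : ℝ) ≤ (Nat.card {u : V | u ∈ S ∧ G.Adj v u} : ℝ)}

/-- `G` is a robust `(ν, τ)`-expander. -/
def RobustExpander {V : Type*} [Fintype V] (G : SimpleGraph V) (ν τ : ℝ) : Prop :=
  ∀ S : Set V,
    τ * (Fintype.card V : ℝ) ≤ (Nat.card S : ℝ) →
    (Nat.card S : ℝ) ≤ (1 - τ) * (Fintype.card V : ℝ) →
    (Nat.card S : ℝ) + ν * (Fintype.card V : ℝ) ≤ (Nat.card (RN G ν S) : ℝ)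

/-- `M` (a set of edges) is a perfect matching of `G`: its edges are edges of `G`,
and every vertex lies in exactly one edge of `M` (in particular the edges are
pairwise disjoint and cover all vertices). -/
def IsPM {V : Type*} (G : SimpleGraph V) (M : Finset (Sym2 V)) : Prop :=
  (∀ e ∈ M, e ∈ G.edgeSet) ∧ ∀ v : V, ∃! e, e ∈ M ∧ v ∈ e

/-- The number of perfect matchings of `G`. -/
noncomputable def pmCount {V : Type*} (G : SimpleGraph V) : ℕ :=
  Nat.card {M : Finset (Sym2 V) // IsPM G M}

/-- `N` (a set of edges) is a matching in `G`: edges of `G`, pairwise disjoint. -/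
def IsMatchingIn {V : Type*} (G : SimpleGraph V) (N : Finset (Sym2 V)) : Prop :=
  (∀ e ∈ N, e ∈ G.edgeSet) ∧ ∀ e ∈ N, ∀ f ∈ N, e ≠ f → ∀ v : V, v ∈ e → v ∉ f

/-- `G` is `d`-regular: every vertex has exactly `d` neighbours. -/
def RegularDeg {V : Type*} (G : SimpleGraph V) (d : ℕ) : Prop :=
  ∀ v : V, Nat.card {u : V | G.Adj v u} = d

/-- Probability that a uniformly random perfect matching of `G` contains the edge `e`. -/
noncomputable def edgeProb {V : Type*} (G : SimpleGraph V) (e : Sym2 V) : ℝ :=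
  (Nat.card {M : Finset (Sym2 V) // IsPM G M ∧ e ∈ M} : ℝ) / (pmCount G : ℝ)

/-- `P[X = k]` where `X = |M ∩ N|` for a uniformly random perfect matching `M` of `G`. -/
noncomputable def interProb {V : Type*} [DecidableEq V] (G : SimpleGraph V)
    (N : Finset (Sym2 V)) (k : ℕ) : ℝ :=
  (Nat.card {M : Finset (Sym2 V) // IsPM G M ∧ (M ∩ N).card = k} : ℝ) / (pmCount G : ℝ)

/-- The Poisson probability mass function with parameter `lam`. -/
noncomputable def poissonPMF (lam : ℝ) (k : ℕ) : ℝ :=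
  Real.exp (-lam) * lam ^ k / (Nat.factorial k)

section Kernel

variable {V : Type*} [Fintype V]

/-- A nonnegative square matrix whose row and column sums lie in `[1 - η, 1]`. -/
structure NearBistochastic (Q : Matrix V V ℝ) (η : ℝ) : Prop where
  nonneg : ∀ x y, 0 ≤ Q x y
  row_le : ∀ x, ∑ y, Q x y ≤ 1
  le_row : ∀ x, 1 - η ≤ ∑ y, Q x y
  col_le : ∀ y, ∑ x, Q x y ≤ 1
  le_col : ∀ y, 1 - η ≤ ∑ x, Q x y

theorem NearBistochastic.mul {P Q : Matrix V V ℝ} {η θ : ℝ} (hP : NearBistochastic P η)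
    (hQ : NearBistochastic Q θ) (hη : 0 ≤ η) (hθ : 0 ≤ θ) :
    NearBistochastic (P * Q) (η + θ) := by
  have row : ∀ x, ∑ y, (P * Q) x y = ∑ w, P x w * ∑ y, Q w y := fun x => by
    simp only [Matrix.mul_apply, Finset.mul_sum]
    exact Finset.sum_comm
  have col : ∀ y, ∑ x, (P * Q) x y = ∑ w, (∑ x, P x w) * Q w y := fun y => by
    simp only [Matrix.mul_apply, Finset.sum_mul]
    exact Finset.sum_comm
  refine ⟨fun x y => ?_, fun x => ?_, fun x => ?_, fun y => ?_, fun y => ?_⟩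
  · rw [Matrix.mul_apply]
    exact Finset.sum_nonneg fun w _ => mul_nonneg (hP.nonneg _ _) (hQ.nonneg _ _)
  · rw [row]
    refine le_trans (Finset.sum_le_sum fun w _ => ?_) (hP.row_le x)
    exact mul_le_of_le_one_right (hP.nonneg _ _) (hQ.row_le w)
  · rw [row]
    have h : ∑ w, P x w * (1 - θ) ≤ ∑ w, P x w * ∑ y, Q w y :=
      Finset.sum_le_sum fun w _ => mul_le_mul_of_nonneg_left (hQ.le_row w) (hP.nonneg _ _)
    rw [← Finset.sum_mul] at h
    nlinarith [hP.le_row x, hP.row_le x]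
  · rw [col]
    refine le_trans (Finset.sum_le_sum fun w _ => ?_) (hQ.col_le y)
    exact mul_le_of_le_one_left (hQ.nonneg _ _) (hP.col_le w)
  · rw [col]
    have h : ∑ w, (1 - η) * Q w y ≤ ∑ w, (∑ x, P x w) * Q w y :=
      Finset.sum_le_sum fun w _ => mul_le_mul_of_nonneg_right (hP.le_col w) (hQ.nonneg _ _)
    rw [← Finset.mul_sum] at h
    nlinarith [hQ.le_col y, hQ.col_le y]

/-- One application of a kernel with all entries at least `c / n` contracts oscillations. -/
theorem osc_mulVec_le {P : Matrix V V ℝ} {θ c : ℝ} (hP : NearBistochastic P θ) (hθ : 0 ≤ θ)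
    (hc : ∀ x y, c / Fintype.card V ≤ P x y) (f : V → ℝ) (hf : ∀ x, 0 ≤ f x)
    (hsum : ∑ x, f x ≤ 1) {D : ℝ} (hD : ∀ x y, f x - f y ≤ D) (x y : V) :
    ∑ w, P x w * f w - ∑ w, P y w * f w ≤ (1 - c) * D + θ / Fintype.card V := by
  have : Nonempty V := ⟨x⟩
  have hn : (0 : ℝ) < Fintype.card V := by exact_mod_cast Fintype.card_pos
  obtain ⟨z, hz⟩ := Finite.exists_min f
  have hm : f z ≤ 1 / Fintype.card V := by
    rw [le_div_iff₀ hn]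
    have : ∑ _x : V, f z ≤ ∑ x, f x := Finset.sum_le_sum fun w _ => hz w
    simp only [sum_const, card_univ, nsmul_eq_mul] at this
    linarith
  have sumc : ∑ _w : V, c / (Fintype.card V : ℝ) = c := by
    simp only [sum_const, card_univ, nsmul_eq_mul]; field_simp
  have h1 : ∑ w, (P x w - c / Fintype.card V) * (f w - f z) ≤
      ∑ w, (P x w - c / Fintype.card V) * D :=
    Finset.sum_le_sum fun w _ => mul_le_mul_of_nonneg_left (hD w z) (by linarith [hc x w])
  have h2 : 0 ≤ ∑ w, (P y w - c / Fintype.card V) * (f w - f z) :=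
    Finset.sum_nonneg fun w _ => mul_nonneg (by linarith [hc y w]) (by linarith [hz w])
  rw [← Finset.sum_mul, Finset.sum_sub_distrib, sumc] at h1
  have hD0 : 0 ≤ D := by simpa using hD z z
  have e : ∑ w, P x w * f w - ∑ w, P y w * f w =
      ∑ w, (P x w - c / Fintype.card V) * (f w - f z) -
        ∑ w, (P y w - c / Fintype.card V) * (f w - f z) +
        f z * (∑ w, P x w - ∑ w, P y w) := by
    rw [← Finset.sum_sub_distrib, ← Finset.sum_sub_distrib, ← Finset.sum_sub_distrib,
      Finset.mul_sum, ← Finset.sum_add_distrib]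
    exact Finset.sum_congr rfl fun w _ => by ring
  have h3 : f z * (∑ w, P x w - ∑ w, P y w) ≤ 1 / Fintype.card V * θ := by
    rcases le_total 0 (∑ w, P x w - ∑ w, P y w) with h0 | h0
    · exact mul_le_mul hm (by linarith [hP.row_le x, hP.le_row y]) h0 (by positivity)
    · exact (mul_nonpos_of_nonneg_of_nonpos (hf z) h0).trans (by positivity)
  have h4 : (∑ w, P x w - c) * D ≤ (1 - c) * D :=
    mul_le_mul_of_nonneg_right (by linarith [hP.row_le x]) hD0
  rw [e]
  have : 1 / (Fintype.card V : ℝ) * θ = θ / Fintype.card V := by ring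
  linarith

variable [DecidableEq V]

theorem NearBistochastic.pow {Q : Matrix V V ℝ} {η : ℝ} (hQ : NearBistochastic Q η)
    (hη : 0 ≤ η) (k : ℕ) : NearBistochastic (Q ^ k) (k * η) := by
  induction k with
  | zero =>
    refine ⟨fun x y => ?_, fun x => ?_, fun x => ?_, fun y => ?_, fun y => ?_⟩ <;>
      simp only [pow_zero, Matrix.one_apply] <;> first | (split_ifs <;> norm_num) | simp
  | succ k ih =>
    have := ih.mul hQ (by positivity) hη
    rw [pow_succ]
    convert this using 1
    push_cast; ring

theorem osc_pow_le {Q : Matrix V V ℝ} {η c : ℝ} {K : ℕ} (hQ : NearBistochastic Q η)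
    (hη : 0 ≤ η) (hc0 : 0 < c)
    (hc : ∀ x y, c / Fintype.card V ≤ (Q ^ K) x y) (j : ℕ) (x y z : V) :
    (Q ^ (K * j)) x z - (Q ^ (K * j)) y z ≤ (1 - c) ^ j + K * η / (c * Fintype.card V) := by
  have : Nonempty V := ⟨x⟩
  have hn : (0 : ℝ) < Fintype.card V := by exact_mod_cast Fintype.card_pos
  induction j generalizing x y with
  | zero =>
    have : 0 ≤ K * η / (c * Fintype.card V) := by positivity
    simp only [mul_zero, pow_zero, Matrix.one_apply]
    split_ifs <;> linarith
  | succ j ih =>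
    have hp := hQ.pow hη (K * j)
    have := osc_mulVec_le (hQ.pow hη K) (by positivity) hc (fun w => (Q ^ (K * j)) w z)
      (fun w => hp.nonneg w z) (hp.col_le z) (fun x y => ih x y) x y
    rw [mul_add, mul_one, add_comm, pow_add, Matrix.mul_apply, Matrix.mul_apply]
    refine this.trans (le_of_eq ?_)
    field_simp
    ring

/-- Quantitative mixing of a nearly bistochastic kernel satisfying a Doeblin condition. -/
theorem abs_pow_sub_le {Q : Matrix V V ℝ} {η c : ℝ} {K : ℕ} (hQ : NearBistochastic Q η)
    (hη : 0 ≤ η) (hc0 : 0 < c)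
    (hc : ∀ x y, c / Fintype.card V ≤ (Q ^ K) x y) (j : ℕ) (x z : V) :
    |Fintype.card V * (Q ^ (K * j)) x z - 1| ≤
      K * j * η + Fintype.card V * (1 - c) ^ j + K * η / c := by
  have : Nonempty V := ⟨x⟩
  have hn : (0 : ℝ) < Fintype.card V := by exact_mod_cast Fintype.card_pos
  have hp := hQ.pow hη (K * j)
  have ho := fun x y => osc_pow_le hQ hη hc0 hc j x y z
  set D := (1 - c) ^ j + K * η / (c * Fintype.card V) with hD
  have e : Fintype.card V * (1 - c) ^ j + K * η / c = Fintype.card V * D := by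
    rw [hD]; field_simp
  have e1 : ∑ _w : V, ((Q ^ (K * j)) x z) = Fintype.card V * (Q ^ (K * j)) x z := by simp
  have e2 : ∑ _w : V, D = Fintype.card V * D := by simp
  have h1 : ∑ _w : V, ((Q ^ (K * j)) x z) ≤ ∑ w, ((Q ^ (K * j)) w z + D) :=
    Finset.sum_le_sum fun w _ => by linarith [ho x w]
  have h2 : ∑ w, ((Q ^ (K * j)) w z - D) ≤ ∑ _w : V, ((Q ^ (K * j)) x z) :=
    Finset.sum_le_sum fun w _ => by linarith [ho w x]
  rw [Finset.sum_add_distrib, e1, e2] at h1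
  rw [Finset.sum_sub_distrib, e1, e2] at h2
  have hc1 := hp.col_le z
  have hc2 := hp.le_col z
  push_cast at hc2
  have : 0 ≤ (K : ℝ) * j * η := by positivity
  rw [add_assoc, e, abs_le]
  constructor <;> linarith

theorem abs_mul_pow_succ_sub_le {Q : Matrix V V ℝ} {η E : ℝ} (hQ : NearBistochastic Q η)
    (hη : 0 ≤ η) (k : ℕ) (z : V)
    (hE : ∀ x, |Fintype.card V * (Q ^ k) x z - 1| ≤ E) (x : V) :
    |Fintype.card V * (Q ^ (k + 1)) x z - 1| ≤ E + η := by
  have hE0 : 0 ≤ E := (abs_nonneg _).trans (hE x)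
  have e : Fintype.card V * (Q ^ (k + 1)) x z - 1 =
      ∑ w, Q x w * (Fintype.card V * (Q ^ k) w z - 1) + (∑ w, Q x w - 1) := by
    rw [pow_succ', Matrix.mul_apply, Finset.mul_sum, add_sub, ← Finset.sum_add_distrib]
    congr 1
    exact Finset.sum_congr rfl fun w _ => by ring
  have h1 : |∑ w, Q x w * (Fintype.card V * (Q ^ k) w z - 1)| ≤ E := by
    refine (Finset.abs_sum_le_sum_abs _ _).trans ?_
    have : ∀ w ∈ univ, |Q x w * (Fintype.card V * (Q ^ k) w z - 1)| ≤ Q x w * E := fun w _ => by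
      rw [abs_mul, abs_of_nonneg (hQ.nonneg x w)]
      exact mul_le_mul_of_nonneg_left (hE w) (hQ.nonneg x w)
    refine (Finset.sum_le_sum this).trans ?_
    rw [← Finset.sum_mul]
    exact mul_le_of_le_one_left hE0 (hQ.row_le x)
  have h2 : |∑ w, Q x w - 1| ≤ η := by
    rw [abs_le]; constructor <;> linarith [hQ.row_le x, hQ.le_row x]
  rw [e]
  exact (abs_add_le _ _).trans (add_le_add h1 h2)

/-- A kernel that dominates a robustly expanding relation satisfies a Doeblin condition. -/
theorem doeblin_of_expansion {Q : Matrix V V ℝ} (R : V → V → Prop) [DecidableRel R]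
    {ν τ : ℝ} (hν : 0 < ν) (hQ0 : ∀ x y, 0 ≤ Q x y)
    (hQ : ∀ x y, R x y → 1 / (Fintype.card V : ℝ) ≤ Q x y)
    (hdeg : ∀ x, τ * Fintype.card V ≤ (univ.filter fun y => R x y).card)
    (hexp : ∀ S : Finset V, τ * Fintype.card V ≤ S.card →
      min (Fintype.card V : ℝ) (S.card + ν * Fintype.card V) ≤
        ((univ.filter fun y => ν * Fintype.card V ≤
          ((S.filter fun w => R w y).card : ℝ)).card : ℝ))
    {k : ℕ} (hk : 1 ≤ k * ν) (x y : V) :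
    ν ^ k / Fintype.card V ≤ (Q ^ (k + 1)) x y := by
  have : Nonempty V := ⟨x⟩
  have hn : (0 : ℝ) < Fintype.card V := by exact_mod_cast Fintype.card_pos
  have key : ∀ k : ℕ, ∃ S : Finset V, τ * Fintype.card V ≤ S.card ∧
      min (Fintype.card V : ℝ) (k * ν * Fintype.card V) ≤ S.card ∧
      ∀ y ∈ S, ν ^ k / Fintype.card V ≤ (Q ^ (k + 1)) x y := by
    intro k
    induction k with
    | zero =>
      refine ⟨univ.filter fun y => R x y, hdeg x, ?_, fun y hy => ?_⟩
      · exact (min_le_right _ _).trans (by simp)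
      · simpa using hQ x y (by simpa using hy)
    | succ k ih =>
      obtain ⟨S, hS, hSk, hSQ⟩ := ih
      have h := hexp S hS
      have hcard : (S.card : ℝ) ≤ Fintype.card V := by exact_mod_cast S.card_le_univ
      refine ⟨univ.filter fun y => ν * Fintype.card V ≤ ((S.filter fun w => R w y).card : ℝ),
        ?_, ?_, fun y hy => ?_⟩
      · refine le_trans ?_ h
        exact le_min (hS.trans hcard) (by nlinarith)
      · refine le_trans ?_ h
        refine le_min (min_le_left _ _) ?_
        rcases le_total (Fintype.card V : ℝ) (k * ν * Fintype.card V) with h' | h'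
        · rw [min_eq_left h'] at hSk
          refine (min_le_left _ _).trans ?_
          nlinarith
        · rw [min_eq_right h'] at hSk
          refine (min_le_right _ _).trans ?_
          push_cast; linarith
      · rw [mem_filter] at hy
        rw [pow_succ Q (k + 1), Matrix.mul_apply]
        have hp : ∀ w, 0 ≤ (Q ^ (k + 1)) x w := by
          have : ∀ m : ℕ, ∀ w, 0 ≤ (Q ^ m) x w := by
            intro m
            induction m with
            | zero => intro w; rw [pow_zero, Matrix.one_apply]; split_ifs <;> norm_num
            | succ m ihm =>
              intro w
              rw [pow_succ, Matrix.mul_apply]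
              exact Finset.sum_nonneg fun w' _ => mul_nonneg (ihm w') (hQ0 _ _)
          exact this _
        calc ν ^ (k + 1) / (Fintype.card V : ℝ)
            = (ν * Fintype.card V) * (ν ^ k / Fintype.card V * (1 / Fintype.card V)) := by
              field_simp; ring
          _ ≤ ((S.filter fun w => R w y).card : ℝ) *
                (ν ^ k / Fintype.card V * (1 / Fintype.card V)) :=
              mul_le_mul_of_nonneg_right hy.2 (by positivity)
          _ = ∑ w ∈ S.filter (fun w => R w y), ν ^ k / Fintype.card V * (1 / Fintype.card V) := by
              rw [sum_const, nsmul_eq_mul]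
          _ ≤ ∑ w ∈ S.filter (fun w => R w y), (Q ^ (k + 1)) x w * Q w y := by
              refine Finset.sum_le_sum fun w hw => ?_
              rw [mem_filter] at hw
              exact mul_le_mul (hSQ w hw.1) (hQ w y hw.2) (by positivity) (hp w)
          _ ≤ ∑ w, (Q ^ (k + 1)) x w * Q w y :=
              Finset.sum_le_sum_of_subset_of_nonneg (Finset.subset_univ _)
                fun w _ _ => mul_nonneg (hp w) (hQ0 w y)
  obtain ⟨S, -, hS, hSQ⟩ := key k
  have : S = univ := by
    rw [← Finset.card_eq_iff_eq_univ]
    apply le_antisymm S.card_le_univ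
    rw [min_eq_left (by nlinarith)] at hS
    exact_mod_cast hS
  exact hSQ y (this ▸ mem_univ y)

end Kernel

section Walks

theorem card_biUnion_image_cons {V : Type*} [DecidableEq V] (s : Finset V) (f : V → Finset (List V)) :
    (s.biUnion fun a => (f a).image (List.cons a)).card = ∑ a ∈ s, (f a).card := by
  rw [Finset.card_biUnion]
  · exact Finset.sum_congr rfl fun a _ => Finset.card_image_of_injective _ List.cons_injective
  · intro a _ b _ hab
    simp only [Finset.disjoint_left, mem_image]
    rintro _ ⟨l, -, rfl⟩ ⟨l', -, h⟩
    exact hab (List.cons.inj h).1.symm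

variable {V : Type*} [Fintype V] [DecidableEq V] (R : V → V → Prop) [DecidableRel R]

/-- The lists of `k` intermediate vertices of `R`-walks from `x` to `z`. -/
def walks : ℕ → V → V → Finset (List V)
  | 0, x, z => if R x z then {[]} else ∅
  | k + 1, x, z => (univ.filter fun a => R x a).biUnion fun a => (walks k a z).image (List.cons a)

/-- The walks of `walks R k x z` whose intermediate vertices avoid `F`, are distinct, and are
not matched to one another by `σ`. -/
def avoidingWalks (σ : V → V) : ℕ → Finset V → V → V → Finset (List V)
  | 0, _, x, z => if R x z then {[]} else ∅
  | k + 1, F, x, z => (univ.filter fun a => R x a ∧ a ∉ F).biUnion fun a =>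
      (avoidingWalks σ k (insert a (insert (σ a) F)) a z).image (List.cons a)

theorem mem_walks {k : ℕ} {x z : V} {l : List V} :
    l ∈ walks R k x z ↔ l.length = k ∧ List.IsChain R (x :: (l ++ [z])) := by
  induction k generalizing x l with
  | zero =>
    rw [walks]
    split_ifs with h
    · cases l <;> simp [h]
    · cases l <;> simp [h]
  | succ k ih =>
    rw [walks]
    cases l with
    | nil => simp
    | cons a l => simp [ih]; tauto

theorem mem_of_mem_avoidingWalks {σ : V → V} (hσ : ∀ x, σ (σ x) = x) (hne : ∀ x, σ x ≠ x)
    {k : ℕ} {F : Finset V} {x z : V} {l : List V} (h : l ∈ avoidingWalks R σ k F x z) :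
    l ∈ walks R k x z ∧ (∀ a ∈ l, a ∉ F) ∧ l.Nodup ∧ ∀ a ∈ l, ∀ b ∈ l, σ a ≠ b := by
  induction k generalizing x l F with
  | zero =>
    rw [avoidingWalks] at h
    rw [walks]
    split_ifs at h with h'
    · rw [mem_singleton] at h
      subst h
      simp [h']
    · simp at h
  | succ k ih =>
    rw [avoidingWalks] at h
    simp only [mem_biUnion, mem_filter, mem_univ, true_and, mem_image] at h
    obtain ⟨a, ⟨hR, haF⟩, l', hl', rfl⟩ := h
    obtain ⟨h1, h2, h3, h4⟩ := ih hl'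
    simp only [mem_insert, not_or] at h2
    refine ⟨?_, ?_, ?_, ?_⟩
    · rw [walks]
      simp only [mem_biUnion, mem_filter, mem_univ, true_and, mem_image]
      exact ⟨a, hR, l', h1, rfl⟩
    · intro b hb
      rcases List.mem_cons.1 hb with rfl | hb
      · exact haF
      · exact (h2 b hb).2.2
    · exact List.nodup_cons.2 ⟨fun ha => (h2 a ha).1 rfl, h3⟩
    · intro b hb c hc
      rcases List.mem_cons.1 hb with rfl | hb' <;> rcases List.mem_cons.1 hc with rfl | hc'
      · exact hne _
      · exact fun e => (h2 c hc').2.1 e.symm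
      · exact fun e => (h2 b hb').2.1 (by rw [← e, hσ])
      · exact h4 b hb' c hc'

theorem card_walks_le {d : ℕ} (hd : ∀ x, (univ.filter fun a => R x a).card ≤ d) (k : ℕ)
    (x z : V) : (walks R k x z).card ≤ d ^ k := by
  induction k generalizing x with
  | zero => rw [walks]; split_ifs <;> simp
  | succ k ih =>
    rw [walks, card_biUnion_image_cons]
    refine (Finset.sum_le_card_nsmul _ _ _ fun a _ => ih a).trans ?_
    rw [smul_eq_mul, pow_succ']
    exact Nat.mul_le_mul_right _ (hd x)

theorem card_walks_le_card_avoidingWalks (σ : V → V) {d : ℕ}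
    (hd : ∀ x, (univ.filter fun a => R x a).card ≤ d) (k : ℕ) (F : Finset V) (x z : V) :
    (walks R k x z).card ≤
      (avoidingWalks R σ k F x z).card + k * (F.card + 2 * k) * d ^ (k - 1) := by
  induction k generalizing x F with
  | zero => rw [walks, avoidingWalks]; simp
  | succ k ih =>
    rw [walks, avoidingWalks, card_biUnion_image_cons, card_biUnion_image_cons,
      ← Finset.sum_filter_add_sum_filter_not _ (fun a => a ∉ F), Finset.filter_filter,
      Finset.filter_filter]
    have h1 : ∑ a ∈ univ.filter (fun a => R x a ∧ a ∉ F), (walks R k a z).card ≤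
        ∑ a ∈ univ.filter (fun a => R x a ∧ a ∉ F),
          (avoidingWalks R σ k (insert a (insert (σ a) F)) a z).card +
        k * (F.card + 2 * (k + 1)) * d ^ k := by
      have : ∀ a ∈ univ.filter (fun a => R x a ∧ a ∉ F), (walks R k a z).card ≤
          (avoidingWalks R σ k (insert a (insert (σ a) F)) a z).card +
            k * (F.card + 2 * (k + 1)) * d ^ (k - 1) := fun a _ => by
        refine (ih (insert a (insert (σ a) F)) a).trans ?_
        have := Finset.card_insert_le a (insert (σ a) F)
        have := Finset.card_insert_le (σ a) F
        exact Nat.add_le_add_left (Nat.mul_le_mul_right _ (Nat.mul_le_mul_left _ (by omega))) _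
      refine (Finset.sum_le_sum this).trans ?_
      rw [Finset.sum_add_distrib, sum_const, smul_eq_mul]
      refine Nat.add_le_add_left ?_ _
      have hc : (univ.filter (fun a => R x a ∧ a ∉ F)).card ≤ d :=
        (Finset.card_le_card fun a ha => by simp at ha ⊢; exact ha.1).trans (hd x)
      refine (Nat.mul_le_mul_right _ hc).trans ?_
      cases k with
      | zero => simp
      | succ k => simp only [Nat.add_sub_cancel]; rw [pow_succ]; apply le_of_eq; ring
    have h2 : ∑ a ∈ univ.filter (fun a => R x a ∧ ¬ a ∉ F), (walks R k a z).card ≤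
        F.card * d ^ k := by
      refine (Finset.sum_le_card_nsmul _ _ _ fun a _ => card_walks_le R hd k a z).trans ?_
      rw [smul_eq_mul]
      exact Nat.mul_le_mul_right _ (Finset.card_le_card fun a ha => by simp at ha; exact ha.2)
    refine (add_le_add h1 h2).trans ?_
    simp only [Nat.add_sub_cancel]
    nlinarith [Nat.zero_le (k * d ^ k), Nat.zero_le (d ^ k)]

/-- The transition matrix of an `R`-walk, normalised by `d`. -/
noncomputable def stepMatrix (d : ℕ) : Matrix V V ℝ :=
  Matrix.of fun x y => if R x y then 1 / (d : ℝ) else 0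

theorem card_walks_eq {d : ℕ} (hd : d ≠ 0) (k : ℕ) (x z : V) :
    ((walks R k x z).card : ℝ) = d ^ (k + 1) * (stepMatrix R d ^ (k + 1)) x z := by
  have hd' : (d : ℝ) ≠ 0 := by exact_mod_cast hd
  induction k generalizing x with
  | zero => rw [walks]; split_ifs with h <;> simp [stepMatrix, h, hd']
  | succ k ih =>
    rw [walks, card_biUnion_image_cons, pow_succ' (stepMatrix R d), Matrix.mul_apply,
      Finset.sum_filter, Nat.cast_sum, Finset.mul_sum]
    refine Finset.sum_congr rfl fun a _ => ?_
    by_cases h : R x a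
    · rw [if_pos h, ih]
      simp only [stepMatrix, Matrix.of_apply, if_pos h]
      field_simp
      ring
    · simp [h, stepMatrix]

end Walks

section Switching

variable {V : Type*}

/-- A perfect matching of `G`, encoded as a fixed-point-free involution along edges of `G`. -/
structure IsMatchingPerm (G : SimpleGraph V) (σ : Equiv.Perm V) : Prop where
  inv : ∀ x, σ (σ x) = x
  adj : ∀ x, G.Adj x (σ x)

theorem IsMatchingPerm.conj {G : SimpleGraph V} {σ c : Equiv.Perm V} (hσ : IsMatchingPerm G σ)
    {xs : List V} (hfix : ∀ a, a ∉ xs → c a = a) (hmem : ∀ a, c a ∈ xs ↔ a ∈ xs)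
    (hfree : ∀ a ∈ xs, ∀ b ∈ xs, σ a ≠ b) (hadj : ∀ a ∈ xs, G.Adj a (σ (c a))) :
    IsMatchingPerm G (c⁻¹ * σ * c) ∧ ∀ a ∈ xs, (c⁻¹ * σ * c) a = σ (c a) := by
  have happ : ∀ a ∈ xs, (c⁻¹ * σ * c) a = σ (c a) := fun a ha => by
    have h : σ (c a) ∉ xs := fun h => hfree _ ((hmem a).2 ha) _ h rfl
    simp only [Equiv.Perm.mul_apply, Equiv.Perm.inv_eq_iff_eq]
    exact (hfix _ h).symm
  refine ⟨⟨fun x => ?_, fun x => ?_⟩, happ⟩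
  · simp [Equiv.Perm.mul_apply, hσ.inv]
  · by_cases hx : x ∈ xs
    · rw [happ x hx]; exact hadj x hx
    · simp only [Equiv.Perm.mul_apply, hfix x hx]
      by_cases hy : σ x ∈ xs
      · have hw : c⁻¹ (σ x) ∈ xs := by rw [← hmem]; simpa using hy
        have := hadj _ hw
        rw [show c (c⁻¹ (σ x)) = σ x by simp, hσ.inv] at this
        exact this.symm
      · have : c⁻¹ (σ x) = σ x := by
          rw [Equiv.Perm.inv_eq_iff_eq]; exact (hfix _ hy).symm
        rw [this]; exact hσ.adj x

variable [DecidableEq V]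

theorem isChain_closed_iff (R : V → V → Prop) {x : V} {l : List V} (h : (x :: l).Nodup) :
    List.IsChain R (x :: (l ++ [x])) ↔ ∀ a ∈ x :: l, R a ((x :: l).formPerm a) := by
  have e : ∀ (i : ℕ) (hi : i < (x :: l).length) (hi' : i < (x :: (l ++ [x])).length),
      (x :: (l ++ [x]))[i] = (x :: l)[i] := by
    intro i hi hi'
    simp only [← List.cons_append]
    exact List.getElem_append_left hi
  have e' : ∀ (i : ℕ) (hi : i < (x :: l).length) (hi' : i + 1 < (x :: (l ++ [x])).length),
      (x :: (l ++ [x]))[i + 1] =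
        (x :: l)[(i + 1) % (x :: l).length]'(Nat.mod_lt _ (by simp)) := by
    intro i hi hi'
    rcases Nat.lt_or_ge (i + 1) (x :: l).length with h1 | h1
    · simp only [Nat.mod_eq_of_lt h1]
      exact e _ h1 _
    · have h2 : i + 1 = (x :: l).length := by omega
      simp only [h2, Nat.mod_self]
      simp
  rw [List.isChain_iff_getElem]
  constructor
  · intro H a ha
    obtain ⟨i, hi, rfl⟩ := List.getElem_of_mem ha
    rw [List.formPerm_apply_getElem _ h]
    have := H i (by simpa using hi)
    rwa [e i hi, e' i hi] at this
  · intro H i hi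
    have hi' : i < (x :: l).length := by simpa using hi
    have := H _ (List.getElem_mem hi')
    rw [List.formPerm_apply_getElem _ h] at this
    rwa [e i hi', e' i hi']

variable [Fintype V]

/-- The lists of length `k`, as a finset. -/
noncomputable def listsOfLength (V : Type*) [Finite V] (k : ℕ) : Finset (List V) :=
  (List.finite_length_eq V k).toFinset

omit [DecidableEq V] in
theorem mem_listsOfLength {k : ℕ} {l : List V} : l ∈ listsOfLength V k ↔ l.length = k := by
  simp [listsOfLength]

open scoped Classical in
/-- Vertex lists of length `m + 2` starting at `u` that trace a `σ`-alternating cycle, each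
listed vertex being followed by a non-matching edge. -/
noncomputable def cyclesThrough (G : SimpleGraph V) (m : ℕ) (u : V) (σ : Equiv.Perm V) :
    Finset (List V) :=
  (listsOfLength V (m + 2)).filter fun xs => xs.head? = some u ∧ xs.Nodup ∧
    (∀ a ∈ xs, ∀ b ∈ xs, σ a ≠ b) ∧ ∀ a ∈ xs, G.Adj a (σ (xs.formPerm a))

open scoped Classical in
/-- Vertex lists of length `m + 2` starting at `u` that trace a `σ`-alternating cycle in which
the edge `uv` is a non-matching edge, each listed vertex being followed by a matching edge. -/
noncomputable def cyclesAvoiding (G : SimpleGraph V) (m : ℕ) (u v : V) (σ : Equiv.Perm V) :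
    Finset (List V) :=
  (listsOfLength V (m + 2)).filter fun xs => xs.head? = some u ∧ xs.Nodup ∧
    (∀ a ∈ xs, ∀ b ∈ xs, σ a ≠ b) ∧ (∀ a ∈ xs, G.Adj (xs.formPerm a) (σ a)) ∧
    σ ((xs.formPerm)⁻¹ u) = v

open scoped Classical in
/-- Switching along alternating cycles. -/
theorem sum_cyclesThrough_eq_sum_cyclesAvoiding (G : SimpleGraph V) (m : ℕ) (u v : V) :
    ∑ σ ∈ univ.filter (fun σ : Equiv.Perm V => IsMatchingPerm G σ ∧ σ u = v),
      (cyclesThrough G m u σ).card =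
    ∑ σ ∈ univ.filter (fun σ : Equiv.Perm V => IsMatchingPerm G σ ∧ σ u ≠ v),
      (cyclesAvoiding G m u v σ).card := by
  rw [← Finset.card_sigma, ← Finset.card_sigma]
  have hfix : ∀ (xs : List V) (a : V), a ∉ xs → xs.formPerm a = a := fun xs a ha =>
    List.formPerm_apply_of_notMem ha
  have hfix' : ∀ (xs : List V) (a : V), a ∉ xs → (xs.formPerm)⁻¹ a = a := fun xs a ha => by
    rw [Equiv.Perm.inv_eq_iff_eq]; exact (hfix xs a ha).symm
  have hmem : ∀ (xs : List V) (a : V), xs.formPerm a ∈ xs ↔ a ∈ xs := fun xs a =>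
    List.formPerm_mem_iff_mem
  have hmem' : ∀ (xs : List V) (a : V), (xs.formPerm)⁻¹ a ∈ xs ↔ a ∈ xs := fun xs a => by
    rw [← hmem]; simp
  refine Finset.card_nbij' (fun p => ⟨p.2.formPerm⁻¹ * p.1 * p.2.formPerm, p.2⟩)
    (fun p => ⟨p.2.formPerm * p.1 * p.2.formPerm⁻¹, p.2⟩) ?_ ?_ ?_ ?_
  · rintro ⟨σ, xs⟩ h
    simp only [coe_sigma, Set.mem_sigma_iff, mem_coe, mem_filter, mem_univ, true_and,
      cyclesThrough, cyclesAvoiding, mem_listsOfLength] at h ⊢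
    obtain ⟨⟨hσ, huv⟩, hlen, hu, hnd, hfree, hadj⟩ := h
    obtain ⟨h1, h2⟩ := hσ.conj (hfix xs) (hmem xs) hfree hadj
    have hux : u ∈ xs := List.mem_of_mem_head? hu
    refine ⟨⟨h1, ?_⟩, hlen, hu, hnd, ?_, ?_, ?_⟩
    · rw [h2 u hux, ← huv]
      intro h
      exact (List.formPerm_apply_mem_ne_self_iff _ hnd u hux).2 (by omega) (σ.injective h)
    · intro a ha b hb
      rw [h2 a ha]
      exact hfree _ ((hmem _ _).2 ha) b hb
    · intro a ha
      rw [h2 a ha]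
      exact hσ.adj _
    · rw [h2 _ ((hmem' _ _).2 hux)]
      simpa using huv
  · rintro ⟨σ, xs⟩ h
    simp only [coe_sigma, Set.mem_sigma_iff, mem_coe, mem_filter, mem_univ, true_and,
      cyclesThrough, cyclesAvoiding, mem_listsOfLength] at h ⊢
    obtain ⟨⟨hσ, huv⟩, hlen, hu, hnd, hfree, hadj, hv⟩ := h
    have hadj' : ∀ a ∈ xs, G.Adj a (σ (xs.formPerm⁻¹ a)) := fun a ha => by
      simpa using hadj (xs.formPerm⁻¹ a) ((hmem' _ _).2 ha)
    obtain ⟨h1, h2⟩ := hσ.conj (hfix' xs) (hmem' xs) hfree hadj'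
    rw [inv_inv] at h1 h2
    have hux : u ∈ xs := List.mem_of_mem_head? hu
    refine ⟨⟨h1, ?_⟩, hlen, hu, hnd, ?_, ?_⟩
    · rw [h2 u hux, hv]
    · intro a ha b hb
      rw [h2 a ha]
      exact hfree _ ((hmem' _ _).2 ha) b hb
    · intro a ha
      rw [h2 _ ((hmem _ _).2 ha)]
      simpa using hσ.adj a
  · rintro ⟨σ, xs⟩ -
    simp [mul_assoc]
  · rintro ⟨σ, xs⟩ -
    simp [mul_assoc]

variable (G : SimpleGraph V) [DecidableRel G.Adj]

/-- The relation moving from `x` along an edge of `G` and then along the matching `σ`. -/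
abbrev Step (σ : Equiv.Perm V) (x y : V) : Prop := G.Adj x (σ y)

theorem card_cyclesThrough_le (m : ℕ) (u : V) (σ : Equiv.Perm V) :
    (cyclesThrough G m u σ).card ≤ (walks (Step G σ) (m + 1) u u).card := by
  refine le_trans (Finset.card_le_card ?_) (Finset.card_image_le (f := List.cons u))
  intro xs h
  simp only [cyclesThrough, mem_filter, mem_listsOfLength] at h
  obtain ⟨hlen, hu, hnd, hfree, hadj⟩ := h
  cases xs with
  | nil => simp at hu
  | cons x l =>
    simp only [List.head?_cons, Option.some.injEq] at hu
    subst hu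
    simp only [mem_image, mem_walks]
    exact ⟨l, ⟨by simpa using hlen, (isChain_closed_iff (Step G σ) hnd).2 hadj⟩, rfl⟩

theorem le_card_cyclesThrough {σ : Equiv.Perm V} (hσ : IsMatchingPerm G σ) (m : ℕ) (u : V) :
    (avoidingWalks (Step G σ) σ (m + 1) {u, σ u} u u).card ≤ (cyclesThrough G m u σ).card := by
  have hne : ∀ x, σ x ≠ x := fun x => (hσ.adj x).ne'
  rw [← Finset.card_image_of_injective _ (List.cons_injective (a := u))]
  refine Finset.card_le_card ?_
  intro xs h
  obtain ⟨l, hl, rfl⟩ := mem_image.1 h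
  obtain ⟨h1, h2, h3, h4⟩ := mem_of_mem_avoidingWalks _ hσ.inv hne hl
  rw [mem_walks] at h1
  simp only [mem_insert, mem_singleton, not_or] at h2
  have hnd : (u :: l).Nodup := List.nodup_cons.2 ⟨fun h => (h2 u h).1 rfl, h3⟩
  simp only [cyclesThrough, mem_filter, mem_listsOfLength]
  refine ⟨by simp [h1.1], by simp, hnd, ?_, (isChain_closed_iff (Step G σ) hnd).1 h1.2⟩
  intro a ha b hb
  rcases List.mem_cons.1 ha with rfl | ha' <;> rcases List.mem_cons.1 hb with rfl | hb'
  · exact hne _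
  · exact fun e => (h2 b hb').2 e.symm
  · exact fun e => (h2 a ha').2 (by rw [← e, hσ.inv])
  · exact h4 a ha' b hb'

theorem card_cyclesAvoiding_le {σ : Equiv.Perm V} (hσ : IsMatchingPerm G σ) (m : ℕ) (u v : V) :
    (cyclesAvoiding G m u v σ).card ≤ (walks (Step G σ) m (σ v) u).card := by
  refine le_trans (Finset.card_le_card ?_)
    (Finset.card_image_le (f := fun l => (σ v :: (l ++ [u])).reverse))
  intro xs h
  simp only [cyclesAvoiding, mem_filter, mem_listsOfLength] at h
  obtain ⟨hlen, hu, hnd, hfree, hadj, hv⟩ := h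
  obtain ⟨t, rfl⟩ := List.head?_eq_some_iff.1 hu
  obtain ⟨l, w, rfl⟩ : ∃ l w, t = l ++ [w] := by
    rcases List.eq_nil_or_concat t with rfl | ⟨l, w, rfl⟩
    · simp at hlen
    · exact ⟨l, w, by simp⟩
  have hrev : (u :: (l ++ [w])).reverse = w :: (l.reverse ++ [u]) := by simp
  have hnd' : (w :: (l.reverse ++ [u])).Nodup := by rw [← hrev]; exact List.nodup_reverse.2 hnd
  have hperm : (w :: (l.reverse ++ [u])).formPerm = (u :: (l ++ [w])).formPerm⁻¹ := by
    rw [← hrev, List.formPerm_reverse]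
  have hw : w = σ v := by
    rw [← hv, hσ.inv, ← hperm]
    exact (List.formPerm_cons_concat_apply_last w u l.reverse).symm
  have hc : List.IsChain (Step G σ) (w :: ((l.reverse ++ [u]) ++ [w])) := by
    rw [isChain_closed_iff (Step G σ) hnd', hperm]
    intro a ha
    rw [← hrev, List.mem_reverse] at ha
    have := hadj ((u :: (l ++ [w])).formPerm⁻¹ a)
      (by rw [← List.formPerm_mem_iff_mem]; simpa using ha)
    simpa [Step] using this
  simp only [mem_image, mem_walks]
  refine ⟨l.reverse, ⟨by simpa using hlen, ?_⟩, by simp [hw]⟩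
  rw [← hw]
  rw [← List.cons_append] at hc
  exact (List.isChain_append.1 hc).1

theorem le_card_cyclesAvoiding {σ : Equiv.Perm V} (hσ : IsMatchingPerm G σ) (m : ℕ) {u v : V}
    (huv : G.Adj u v) (hne : σ u ≠ v) :
    (avoidingWalks (Step G σ) σ m {u, σ u, v, σ v} (σ v) u).card ≤
      (cyclesAvoiding G m u v σ).card := by
  have hne' : ∀ x, σ x ≠ x := fun x => (hσ.adj x).ne'
  have huv' : u ≠ v := huv.ne
  have hne2 : σ v ≠ u := fun h => hne (by rw [← h, hσ.inv])
  have hinj : Function.Injective fun l : List V => (σ v :: (l ++ [u])).reverse := by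
    intro l l' h
    simpa using h
  rw [← Finset.card_image_of_injective _ hinj]
  refine Finset.card_le_card ?_
  intro xs h
  obtain ⟨l, hl, rfl⟩ := mem_image.1 h
  obtain ⟨h1, h2, h3, h4⟩ := mem_of_mem_avoidingWalks _ hσ.inv hne' hl
  rw [mem_walks] at h1
  simp only [mem_insert, mem_singleton, not_or] at h2
  have hnd : (σ v :: (l ++ [u])).Nodup := by
    rw [List.nodup_cons, List.nodup_append]
    refine ⟨fun h => ?_, h3, by simp, ?_⟩
    · simp only [List.mem_append, List.mem_singleton] at h
      rcases h with h | h
      · exact (h2 _ h).2.2.2 rfl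
      · exact hne2 h
    · intro a ha b hb
      rw [List.mem_singleton] at hb
      subst hb
      exact (h2 a ha).1
  have hmem : ∀ a, a ∈ σ v :: (l ++ [u]) ↔ a = σ v ∨ a ∈ l ∨ a = u := fun a => by simp
  have hc : List.IsChain (Step G σ) (σ v :: ((l ++ [u]) ++ [σ v])) := by
    rw [← List.cons_append, List.isChain_append]
    refine ⟨h1.2, by simp, ?_⟩
    intro a ha b hb
    rw [← List.cons_append, List.getLast?_concat] at ha
    simp only [Option.mem_def, Option.some.injEq, List.head?_cons] at ha hb
    subst ha hb
    simpa [Step, hσ.inv] using huv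
  rw [isChain_closed_iff (Step G σ) hnd] at hc
  simp only [cyclesAvoiding, mem_filter, mem_listsOfLength, List.formPerm_reverse, List.mem_reverse,
    List.nodup_reverse, inv_inv]
  refine ⟨by simp [h1.1], by simp, hnd, ?_, ?_, ?_⟩
  · intro a ha b hb
    rw [hmem] at ha hb
    rcases ha with rfl | ha | rfl <;> rcases hb with rfl | hb | rfl
    · exact hne' _
    · rw [hσ.inv]; exact fun e => (h2 b hb).2.2.1 e.symm
    · rw [hσ.inv]; exact huv'.symm
    · exact fun e => (h2 a ha).2.2.1 (σ.injective e)
    · exact h4 a ha b hb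
    · exact fun e => (h2 a ha).2.1 (by rw [← e, hσ.inv])
    · exact fun e => huv' (σ.injective e)
    · exact fun e => (h2 b hb).2.1 e.symm
    · exact hne' _
  · intro a ha
    have hm : (σ v :: (l ++ [u])).formPerm⁻¹ a ∈ σ v :: (l ++ [u]) := by
      rw [← List.formPerm_mem_iff_mem]; simpa using ha
    simpa [Step] using hc _ hm
  · rw [List.formPerm_cons_concat_apply_last, hσ.inv]

end Switching

section EdgeRatio

open scoped Classical

variable {V : Type*} [Fintype V]

/-- All degrees of `G` lie in `[d - s, d]`, and every set of at least `τ n` vertices expands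
robustly. -/
structure AlmostRegularExpander (G : SimpleGraph V) (d s : ℕ) (ν τ : ℝ) : Prop where
  degree_le : ∀ x, (univ.filter fun y => G.Adj x y).card ≤ d
  le_degree : ∀ x, d ≤ (univ.filter fun y => G.Adj x y).card + s
  tau_le_degree : ∀ x, τ * Fintype.card V ≤ (univ.filter fun y => G.Adj x y).card
  expand : ∀ S : Finset V, τ * Fintype.card V ≤ S.card →
    min (Fintype.card V : ℝ) (S.card + ν * Fintype.card V) ≤
      ((univ.filter fun y => ν * Fintype.card V ≤
        ((S.filter fun w => G.Adj w y).card : ℝ)).card : ℝ)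

theorem card_filter_perm (σ : Equiv.Perm V) (p : V → Prop) :
    (univ.filter fun y => p (σ y)).card = (univ.filter p).card := by
  rw [← Finset.card_map σ.toEmbedding]
  congr 1
  ext y
  simp only [mem_map, mem_filter, mem_univ, true_and]
  exact ⟨fun ⟨a, ha, e⟩ => e ▸ ha, fun h => ⟨σ⁻¹ y, by simpa using h, by simp⟩⟩

theorem AlmostRegularExpander.nearBistochastic {G : SimpleGraph V} {d s : ℕ} {ν τ : ℝ}
    (hG : AlmostRegularExpander G d s ν τ) (hd : 0 < d) (σ : Equiv.Perm V) :
    NearBistochastic (stepMatrix (Step G σ) d) (s / d) := by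
  have hd' : (0 : ℝ) < d := by exact_mod_cast hd
  have hle : ∀ x, ((univ.filter fun y => G.Adj x y).card : ℝ) * (1 / d) ≤ 1 := fun x => by
    rw [mul_one_div, div_le_one hd']
    exact_mod_cast hG.degree_le x
  have hge : ∀ x, 1 - (s : ℝ) / d ≤ ((univ.filter fun y => G.Adj x y).card : ℝ) * (1 / d) :=
    fun x => by
      have : (d : ℝ) ≤ (univ.filter fun y => G.Adj x y).card + s := by
        exact_mod_cast hG.le_degree x
      rw [mul_one_div, sub_le_iff_le_add, ← add_div, le_div_iff₀ hd']
      linarith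
  have row : ∀ x, ∑ y, stepMatrix (Step G σ) d x y =
      ((univ.filter fun y => G.Adj x y).card : ℝ) * (1 / d) := fun x => by
    simp only [stepMatrix, Matrix.of_apply]
    rw [← Finset.sum_filter, sum_const, nsmul_eq_mul, card_filter_perm σ fun y => G.Adj x y]
  have col : ∀ y, ∑ x, stepMatrix (Step G σ) d x y =
      ((univ.filter fun x => G.Adj (σ y) x).card : ℝ) * (1 / d) := fun y => by
    simp only [stepMatrix, Matrix.of_apply, Step]
    rw [← Finset.sum_filter, sum_const, nsmul_eq_mul]
    simp only [G.adj_comm (σ y)]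
  refine ⟨fun x y => ?_, fun x => ?_, fun x => ?_, fun y => ?_, fun y => ?_⟩
  · simp only [stepMatrix, Matrix.of_apply]; split_ifs <;> positivity
  · rw [row]; exact hle x
  · rw [row]; exact hge x
  · rw [col]; exact hle _
  · rw [col]; exact hge _

theorem AlmostRegularExpander.doeblin {G : SimpleGraph V} {d s : ℕ} {ν τ : ℝ}
    (hG : AlmostRegularExpander G d s ν τ) (hd : 0 < d) (hdn : d ≤ Fintype.card V) (hν : 0 < ν)
    {k : ℕ} (hk : 1 ≤ k * ν) (σ : Equiv.Perm V) (x y : V) :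
    ν ^ k / Fintype.card V ≤ (stepMatrix (Step G σ) d ^ (k + 1)) x y := by
  have hd' : (0 : ℝ) < d := by exact_mod_cast hd
  refine doeblin_of_expansion (Step G σ) (τ := τ) hν (hG.nearBistochastic hd σ).nonneg
    ?_ ?_ ?_ hk x y
  · intro x y h
    simp only [stepMatrix, Matrix.of_apply, if_pos h]
    exact one_div_le_one_div_of_le hd' (by exact_mod_cast hdn)
  · intro x
    rw [card_filter_perm σ fun y => G.Adj x y]
    exact hG.tau_le_degree x
  · intro S hS
    rw [card_filter_perm σ fun y => ν * (Fintype.card V : ℝ) ≤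
      ((S.filter fun w => G.Adj w y).card : ℝ)]
    exact hG.expand S hS

/-- Counts of matchings using, respectively avoiding, an edge determine each other up to a
factor `d (1 ± κ) / (1 ± κ)`. -/
theorem AlmostRegularExpander.card_ratio {G : SimpleGraph V} {d s : ℕ} {ν τ κ : ℝ}
    (hG : AlmostRegularExpander G d s ν τ) (hd : 0 < d) (hdn : d ≤ Fintype.card V) (hν : 0 < ν)
    {k j : ℕ} (hk : 1 ≤ k * ν) (hj : 0 < j)
    (hκ : ((k + 1 : ℕ) : ℝ) * j * (s / d) + Fintype.card V * (1 - ν ^ k) ^ j +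
      ((k + 1 : ℕ) : ℝ) * (s / d) / ν ^ k + s / d +
      ((k + 1) * j : ℕ) * (2 * ((k + 1) * j : ℕ) + 2) * Fintype.card V / (d : ℝ) ^ 2 ≤ κ)
    {u v : V} (huv : G.Adj u v) :
    ((univ.filter fun σ : Equiv.Perm V => IsMatchingPerm G σ ∧ σ u = v).card : ℝ) * d * (1 - κ) ≤
      ((univ.filter fun σ : Equiv.Perm V => IsMatchingPerm G σ ∧ σ u ≠ v).card : ℝ) * (1 + κ) ∧
    ((univ.filter fun σ : Equiv.Perm V => IsMatchingPerm G σ ∧ σ u ≠ v).card : ℝ) * (1 - κ) ≤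
      ((univ.filter fun σ : Equiv.Perm V => IsMatchingPerm G σ ∧ σ u = v).card : ℝ) * d *
        (1 + κ) := by
  have : Nonempty V := ⟨u⟩
  have hn : (0 : ℝ) < Fintype.card V := by exact_mod_cast Fintype.card_pos
  have hd' : (0 : ℝ) < d := by exact_mod_cast hd
  obtain ⟨m, hm⟩ : ∃ m, (k + 1) * j = m + 1 :=
    ⟨(k + 1) * j - 1, (Nat.succ_pred_eq_of_pos (by positivity)).symm⟩
  rw [hm] at hκ
  set E : ℝ := ((k + 1 : ℕ) : ℝ) * j * (s / d) + Fintype.card V * (1 - ν ^ k) ^ j +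
      ((k + 1 : ℕ) : ℝ) * (s / d) / ν ^ k with hE
  set B : ℝ := ((m + 1 : ℕ) : ℝ) * (2 * ((m + 1 : ℕ) : ℝ) + 2) * Fintype.card V / (d : ℝ) ^ 2
    with hB
  have hη : (0 : ℝ) ≤ s / d := by positivity
  have mix : ∀ (σ : Equiv.Perm V) (x z : V),
      |Fintype.card V * (stepMatrix (Step G σ) d ^ (m + 1)) x z - 1| ≤ E := fun σ x z => by
    have := abs_pow_sub_le (hG.nearBistochastic hd σ) hη (by positivity)
      (hG.doeblin hd hdn hν hk σ) j x z
    rwa [hm] at this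
  have mix' : ∀ (σ : Equiv.Perm V) (x z : V),
      |Fintype.card V * (stepMatrix (Step G σ) d ^ (m + 1 + 1)) x z - 1| ≤ E + s / d :=
    fun σ x z => abs_mul_pow_succ_sub_le (hG.nearBistochastic hd σ) hη _ z
      (fun x => mix σ x z) x
  have hdeg : ∀ (σ : Equiv.Perm V) (x : V), (univ.filter fun a => Step G σ x a).card ≤ d :=
    fun σ x => by
      rw [card_filter_perm σ fun y => G.Adj x y]
      exact hG.degree_le x
  have hB0 : 0 ≤ B := by positivity
  have up : ∀ q : ℝ, |Fintype.card V * q - 1| ≤ E + s / d →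
      q ≤ (1 + κ) / Fintype.card V := fun q hq => by
    rw [le_div_iff₀ hn]
    linarith [(abs_le.1 hq).2]
  have low : ∀ q : ℝ, |Fintype.card V * q - 1| ≤ E + s / d →
      (1 - κ) / Fintype.card V ≤ q - B / Fintype.card V := fun q hq => by
    rw [le_sub_iff_add_le, ← add_div, div_le_iff₀ hn]
    linarith [(abs_le.1 hq).1]
  have up1 : ∀ σ : Equiv.Perm V, ((cyclesThrough G m u σ).card : ℝ) ≤
      (d : ℝ) ^ (m + 2) * ((1 + κ) / Fintype.card V) := fun σ => by
    have h1 : ((cyclesThrough G m u σ).card : ℝ) ≤ ((walks (Step G σ) (m + 1) u u).card : ℝ) := by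
      exact_mod_cast card_cyclesThrough_le G m u σ
    rw [card_walks_eq _ hd.ne'] at h1
    exact h1.trans (mul_le_mul_of_nonneg_left (up _ (mix' σ u u)) (by positivity))
  have up2 : ∀ σ : Equiv.Perm V, IsMatchingPerm G σ → ((cyclesAvoiding G m u v σ).card : ℝ) ≤
      (d : ℝ) ^ (m + 1) * ((1 + κ) / Fintype.card V) := fun σ hσ => by
    have h1 : ((cyclesAvoiding G m u v σ).card : ℝ) ≤
        ((walks (Step G σ) m (σ v) u).card : ℝ) := by
      exact_mod_cast card_cyclesAvoiding_le G hσ m u v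
    rw [card_walks_eq _ hd.ne'] at h1
    exact h1.trans (mul_le_mul_of_nonneg_left
      (up _ ((mix σ _ u).trans (by linarith))) (by positivity))
  have low1 : ∀ σ : Equiv.Perm V, IsMatchingPerm G σ →
      (d : ℝ) ^ (m + 2) * ((1 - κ) / Fintype.card V) ≤ ((cyclesThrough G m u σ).card : ℝ) :=
    fun σ hσ => by
      have h1 := card_walks_le_card_avoidingWalks (Step G σ) σ (hdeg σ) (m + 1) {u, σ u} u u
      have h2 := le_card_cyclesThrough G hσ m u
      have h3 : (walks (Step G σ) (m + 1) u u).card ≤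
          (cyclesThrough G m u σ).card + (m + 1) * (2 * (m + 1) + 2) * d ^ m := by
        refine h1.trans (add_le_add h2 (Nat.mul_le_mul_right _ (Nat.mul_le_mul_left _ ?_)))
        have := Finset.card_le_two (a := u) (b := σ u)
        omega
      have h4 : ((walks (Step G σ) (m + 1) u u).card : ℝ) ≤ (cyclesThrough G m u σ).card +
          ((m + 1 : ℕ) : ℝ) * (2 * ((m + 1 : ℕ) : ℝ) + 2) * (d : ℝ) ^ m := by exact_mod_cast h3
      rw [card_walks_eq _ hd.ne'] at h4
      have h5 : ((m + 1 : ℕ) : ℝ) * (2 * ((m + 1 : ℕ) : ℝ) + 2) * (d : ℝ) ^ m =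
          (d : ℝ) ^ (m + 2) * (B / Fintype.card V) := by
        rw [hB]; field_simp; ring
      have h6 := mul_le_mul_of_nonneg_left (low _ (mix' σ u u))
        (show (0 : ℝ) ≤ (d : ℝ) ^ (m + 2) by positivity)
      rw [mul_sub, ← h5] at h6
      linarith
  have low2 : ∀ σ : Equiv.Perm V, IsMatchingPerm G σ → σ u ≠ v →
      (d : ℝ) ^ (m + 1) * ((1 - κ) / Fintype.card V) ≤ ((cyclesAvoiding G m u v σ).card : ℝ) :=
    fun σ hσ hne => by
      have h1 := card_walks_le_card_avoidingWalks (Step G σ) σ (hdeg σ) m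
        {u, σ u, v, σ v} (σ v) u
      have h2 := le_card_cyclesAvoiding G hσ m huv hne
      have h3 : d * (walks (Step G σ) m (σ v) u).card ≤
          d * (cyclesAvoiding G m u v σ).card + (m + 1) * (2 * (m + 1) + 2) * d ^ m := by
        have hc : Finset.card {u, σ u, v, σ v} ≤ 4 := Finset.card_le_four
        have h7 : d * (m * (Finset.card {u, σ u, v, σ v} + 2 * m) * d ^ (m - 1)) ≤
            (m + 1) * (2 * (m + 1) + 2) * d ^ m := by
          cases m with
          | zero => simp
          | succ m =>
            simp only [Nat.add_sub_cancel]
            calc d * ((m + 1) * (Finset.card {u, σ u, v, σ v} + 2 * (m + 1)) * d ^ m)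
                = (m + 1) * (Finset.card {u, σ u, v, σ v} + 2 * (m + 1)) * d ^ (m + 1) := by ring
              _ ≤ _ := Nat.mul_le_mul_right _ (Nat.mul_le_mul (by omega) (by omega))
        calc d * (walks (Step G σ) m (σ v) u).card
            ≤ d * ((cyclesAvoiding G m u v σ).card +
              m * (Finset.card {u, σ u, v, σ v} + 2 * m) * d ^ (m - 1)) :=
              Nat.mul_le_mul_left _ (h1.trans (Nat.add_le_add_right h2 _))
          _ ≤ _ := by rw [mul_add]; exact Nat.add_le_add_left h7 _
      have h4 : (d : ℝ) * ((walks (Step G σ) m (σ v) u).card : ℝ) ≤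
          d * (cyclesAvoiding G m u v σ).card +
          ((m + 1 : ℕ) : ℝ) * (2 * ((m + 1 : ℕ) : ℝ) + 2) * (d : ℝ) ^ m := by exact_mod_cast h3
      rw [card_walks_eq _ hd.ne'] at h4
      have h5 : ((m + 1 : ℕ) : ℝ) * (2 * ((m + 1 : ℕ) : ℝ) + 2) * (d : ℝ) ^ m =
          d * ((d : ℝ) ^ (m + 1) * (B / Fintype.card V)) := by
        rw [hB]; field_simp; ring
      rw [h5, ← mul_add] at h4
      have h4' := le_of_mul_le_mul_left h4 hd'
      have h6 := mul_le_mul_of_nonneg_left (low _ ((mix σ (σ v) u).trans (by linarith)))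
        (show (0 : ℝ) ≤ (d : ℝ) ^ (m + 1) by positivity)
      rw [mul_sub] at h6
      linarith
  have hsw : ∑ σ ∈ univ.filter (fun σ : Equiv.Perm V => IsMatchingPerm G σ ∧ σ u = v),
      ((cyclesThrough G m u σ).card : ℝ) =
    ∑ σ ∈ univ.filter (fun σ : Equiv.Perm V => IsMatchingPerm G σ ∧ σ u ≠ v),
      ((cyclesAvoiding G m u v σ).card : ℝ) := by
    exact_mod_cast sum_cyclesThrough_eq_sum_cyclesAvoiding G m u v
  have hpos : 0 < (d : ℝ) ^ (m + 1) / Fintype.card V := by positivity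
  constructor
  · have h1 := Finset.card_nsmul_le_sum
      (univ.filter fun σ : Equiv.Perm V => IsMatchingPerm G σ ∧ σ u = v) _ _
      fun σ hσ => low1 σ (mem_filter.1 hσ).2.1
    have h2 := Finset.sum_le_card_nsmul
      (univ.filter fun σ : Equiv.Perm V => IsMatchingPerm G σ ∧ σ u ≠ v) _ _
      fun σ hσ => up2 σ (mem_filter.1 hσ).2.1
    rw [nsmul_eq_mul] at h1 h2
    have h3 := (h1.trans hsw.le).trans h2
    refine le_of_mul_le_mul_left ?_ hpos
    refine le_trans (le_of_eq ?_) (h3.trans (le_of_eq ?_)) <;> ring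
  · have h1 := Finset.card_nsmul_le_sum
      (univ.filter fun σ : Equiv.Perm V => IsMatchingPerm G σ ∧ σ u ≠ v) _ _
      fun σ hσ => low2 σ (mem_filter.1 hσ).2.1 (mem_filter.1 hσ).2.2
    have h2 := Finset.sum_le_card_nsmul
      (univ.filter fun σ : Equiv.Perm V => IsMatchingPerm G σ ∧ σ u = v) _ _
      fun σ _ => up1 σ
    rw [nsmul_eq_mul] at h1 h2
    have h3 := (h1.trans hsw.ge).trans h2
    refine le_of_mul_le_mul_left ?_ hpos
    refine le_trans (le_of_eq ?_) (h3.trans (le_of_eq ?_)) <;> ring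

end EdgeRatio

section MatchingEdges

open scoped Classical

variable {V : Type*}

theorem isMatchingPerm_deleteEdges {G : SimpleGraph V} {σ : Equiv.Perm V} {u v : V} :
    IsMatchingPerm (G.deleteEdges {s(u, v)}) σ ↔ IsMatchingPerm G σ ∧ σ u ≠ v := by
  constructor
  · intro h
    have h' : ∀ x, G.Adj x (σ x) ∧ s(x, σ x) ≠ s(u, v) := fun x => by
      simpa [SimpleGraph.deleteEdges_adj] using h.adj x
    exact ⟨⟨h.inv, fun x => (h' x).1⟩, fun e => (h' u).2 (by rw [e])⟩
  · rintro ⟨h, hne⟩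
    refine ⟨h.inv, fun x => ?_⟩
    rw [SimpleGraph.deleteEdges_adj]
    refine ⟨h.adj x, fun e => ?_⟩
    rw [Set.mem_singleton_iff, Sym2.eq_iff] at e
    obtain ⟨rfl, e⟩ | ⟨rfl, rfl⟩ := e
    · exact hne e
    · exact hne (h.inv x)

theorem isPM_deleteEdges {G : SimpleGraph V} {M : Finset (Sym2 V)} {s : Set (Sym2 V)} :
    IsPM (G.deleteEdges s) M ↔ IsPM G M ∧ ∀ e ∈ M, e ∉ s := by
  simp only [IsPM, SimpleGraph.edgeSet_deleteEdges, Set.mem_sdiff, forall_and]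
  tauto

variable [Fintype V]

/-- The edge set of the matching encoded by an involution. -/
noncomputable def matchingEdges (σ : Equiv.Perm V) : Finset (Sym2 V) :=
  univ.image fun x => s(x, σ x)

theorem IsMatchingPerm.mk_mem_matchingEdges {G : SimpleGraph V} {σ : Equiv.Perm V}
    (hσ : IsMatchingPerm G σ) {u v : V} : s(u, v) ∈ matchingEdges σ ↔ σ u = v := by
  simp only [matchingEdges, mem_image, mem_univ, true_and, Sym2.eq_iff]
  constructor
  · rintro ⟨x, ⟨rfl, rfl⟩ | ⟨rfl, rfl⟩⟩
    · rfl
    · exact hσ.inv x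
  · rintro rfl
    exact ⟨u, Or.inl ⟨rfl, rfl⟩⟩

theorem IsMatchingPerm.isPM {G : SimpleGraph V} {σ : Equiv.Perm V} (hσ : IsMatchingPerm G σ) :
    IsPM G (matchingEdges σ) := by
  refine ⟨fun e he => ?_, fun v => ⟨s(v, σ v), ⟨hσ.mk_mem_matchingEdges.2 rfl, by simp⟩, ?_⟩⟩
  · obtain ⟨x, -, rfl⟩ := mem_image.1 he
    exact hσ.adj x
  · rintro e ⟨he, hv⟩
    obtain ⟨w, rfl⟩ := Sym2.mem_iff_exists.1 hv
    rw [hσ.mk_mem_matchingEdges.1 he]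

theorem IsPM.exists_perm {G : SimpleGraph V} {M : Finset (Sym2 V)} (hM : IsPM G M) :
    ∃ σ, IsMatchingPerm G σ ∧ matchingEdges σ = M := by
  have h : ∀ v, ∃ w, s(v, w) ∈ M := fun v => by
    obtain ⟨e, ⟨he, hv⟩, -⟩ := hM.2 v
    obtain ⟨w, rfl⟩ := Sym2.mem_iff_exists.1 hv
    exact ⟨w, he⟩
  choose g hg using h
  have uniq : ∀ v w, s(v, w) ∈ M → g v = w := fun v w hw => by
    have := (hM.2 v).unique ⟨hg v, by simp⟩ ⟨hw, by simp⟩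
    exact Sym2.congr_right.1 this
  have hinv : Function.Involutive g := fun v => uniq _ _ (by rw [Sym2.eq_swap]; exact hg v)
  have hσ : IsMatchingPerm G (hinv.toPerm g) := ⟨hinv, fun v => hM.1 _ (hg v)⟩
  refine ⟨_, hσ, ?_⟩
  ext e
  induction e with
  | _ u v =>
    rw [hσ.mk_mem_matchingEdges]
    exact ⟨fun h => h ▸ hg u, uniq u v⟩

theorem card_isMatchingPerm (G : SimpleGraph V) :
    (univ.filter fun σ : Equiv.Perm V => IsMatchingPerm G σ).card = pmCount G := by
  rw [pmCount, ← Fintype.card_subtype, ← Nat.card_eq_fintype_card]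
  refine Nat.card_congr (Equiv.ofBijective (fun σ => ⟨matchingEdges σ.1, σ.2.isPM⟩) ⟨?_, ?_⟩)
  · rintro ⟨σ, hσ⟩ ⟨ρ, hρ⟩ h
    simp only [Subtype.mk.injEq] at h ⊢
    ext u
    refine (hρ.mk_mem_matchingEdges.1 ?_).symm
    rw [← h, hσ.mk_mem_matchingEdges]
  · rintro ⟨M, hM⟩
    obtain ⟨σ, hσ, rfl⟩ := hM.exists_perm
    exact ⟨⟨σ, hσ⟩, rfl⟩

/-- Two-sided exponential form of a ratio close to `1 / d`. -/
theorem exp_le_add_and_add_le_exp {a b d κ : ℝ} (hb : 0 ≤ b) (hd : 0 < d)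
    (hκ : 1 / d ≤ κ) (hκ4 : κ ≤ 1 / 4) (h₁ : a * d * (1 - κ) ≤ b * (1 + κ))
    (h₂ : b * (1 - κ) ≤ a * d * (1 + κ)) :
    b * Real.exp ((1 - 4 * κ) / d) ≤ a + b ∧ a + b ≤ b * Real.exp ((1 + 4 * κ) / d) := by
  have hκ0 : 0 < κ := lt_of_lt_of_le (by positivity) hκ
  have hκd : 1 ≤ κ * d := by rwa [div_le_iff₀ hd] at hκ
  constructor
  · set y := (1 - 4 * κ) / d with hy
    have hy1 : y < 1 := by rw [hy, div_lt_one hd]; nlinarith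
    have h3 : b * y ≤ a * (1 - y) := by
      rw [hy]
      have : b * (1 - 4 * κ) ≤ a * (d - (1 - 4 * κ)) := by
        have h5 : b * (1 - κ) * (d - (1 - 4 * κ)) ≤ a * d * (1 + κ) * (d - (1 - 4 * κ)) :=
          mul_le_mul_of_nonneg_right h₂ (by nlinarith)
        have h6 : (1 - 4 * κ) * (d * (1 + κ)) ≤ (1 - κ) * (d - (1 - 4 * κ)) := by
          nlinarith [mul_pos hκ0 hκ0, mul_pos hκ0 hd]
        have h7 := mul_le_mul_of_nonneg_left h6 hb
        refine le_of_mul_le_mul_left ?_ (show 0 < d * (1 + κ) by positivity)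
        linarith
      have e1 : b * ((1 - 4 * κ) / d) = b * (1 - 4 * κ) / d := by ring
      have e2 : a * (1 - (1 - 4 * κ) / d) = a * (d - (1 - 4 * κ)) / d := by field_simp
      rw [e1, e2]
      gcongr
    have h4 : 1 - y ≤ Real.exp (-y) := by linarith [Real.add_one_le_exp (-y)]
    have h5 : b ≤ (a + b) * (1 - y) := by linarith
    have ha : 0 ≤ a + b := by
      by_contra! h
      nlinarith
    have h6 := h5.trans (mul_le_mul_of_nonneg_left h4 ha)
    calc b * Real.exp y ≤ (a + b) * Real.exp (-y) * Real.exp y := by gcongr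
      _ = a + b := by rw [mul_assoc, ← Real.exp_add]; simp
  · have h3 : a ≤ b * ((1 + 4 * κ) / d) := by
      rw [← mul_div_assoc, le_div_iff₀ hd]
      have : (1 + κ) ≤ (1 + 4 * κ) * (1 - κ) := by nlinarith
      have := mul_le_mul_of_nonneg_left this hb
      refine le_of_mul_le_mul_right ?_ (show 0 < 1 - κ by linarith)
      linarith
    have h4 := mul_le_mul_of_nonneg_left (Real.add_one_le_exp ((1 + 4 * κ) / d)) hb
    linarith

/-- Smallness condition on the parameters under which single edge probabilities
are `(1 ± 4 κ) / d`. -/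
structure SmallError (n d s k j : ℕ) (ν κ : ℝ) : Prop where
  nu_pos : 0 < ν
  one_le : 1 ≤ k * ν
  j_pos : 0 < j
  inv_le : 1 / (d : ℝ) ≤ κ
  le_quarter : κ ≤ 1 / 4
  error_le : ((k + 1 : ℕ) : ℝ) * j * (s / d) + n * (1 - ν ^ k) ^ j +
      ((k + 1 : ℕ) : ℝ) * (s / d) / ν ^ k + s / d +
      ((k + 1) * j : ℕ) * (2 * ((k + 1) * j : ℕ) + 2) * n / (d : ℝ) ^ 2 ≤ κ

theorem AlmostRegularExpander.pmCount_deleteEdge {G : SimpleGraph V} {d s k j : ℕ} {ν τ κ : ℝ}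
    (hG : AlmostRegularExpander G d s ν τ) (hd : 0 < d) (hdn : d ≤ Fintype.card V)
    (h : SmallError (Fintype.card V) d s k j ν κ) {e : Sym2 V} (he : e ∈ G.edgeSet) :
    pmCount (G.deleteEdges {e}) * Real.exp ((1 - 4 * κ) / d) ≤ pmCount G ∧
    (pmCount G : ℝ) ≤ pmCount (G.deleteEdges {e}) * Real.exp ((1 + 4 * κ) / d) := by
  induction e with
  | _ u v =>
    obtain ⟨h₁, h₂⟩ := hG.card_ratio hd hdn h.nu_pos h.one_le h.j_pos h.error_le
      (show G.Adj u v from he)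
    have hsplit : pmCount G =
        (univ.filter fun σ : Equiv.Perm V => IsMatchingPerm G σ ∧ σ u = v).card +
        (univ.filter fun σ : Equiv.Perm V => IsMatchingPerm G σ ∧ σ u ≠ v).card := by
      rw [← card_isMatchingPerm, ← Finset.filter_filter, ← Finset.filter_filter,
        Finset.card_filter_add_card_filter_not]
    have hdel : pmCount (G.deleteEdges {s(u, v)}) =
        (univ.filter fun σ : Equiv.Perm V => IsMatchingPerm G σ ∧ σ u ≠ v).card := by
      rw [← card_isMatchingPerm]
      simp only [isMatchingPerm_deleteEdges]
    rw [hsplit, hdel, Nat.cast_add]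
    exact exp_le_add_and_add_le_exp (by positivity) (by exact_mod_cast hd) h.inv_le h.le_quarter
      h₁ h₂

end MatchingEdges

section Tuples

open scoped Classical

variable {V : Type*} [Fintype V]

/-- A robust expander stays almost regular and expanding after deletion of few edges at every
vertex. -/
theorem RobustExpander.deleteEdges {G : SimpleGraph V} {d s : ℕ} {ν μ τ : ℝ}
    (hexp : RobustExpander G ν τ) (hreg : RegularDeg G d) {E : Finset (Sym2 V)}
    (hE : ∀ x, (univ.filter fun y => s(x, y) ∈ E).card ≤ s) (hμ : 0 ≤ μ)
    (hs : μ * Fintype.card V + s ≤ ν * Fintype.card V)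
    (hτ : τ * Fintype.card V + μ * Fintype.card V + s ≤ d) :
    AlmostRegularExpander (G.deleteEdges (E : Set (Sym2 V))) d s μ τ := by
  have hadj : ∀ x y, (G.deleteEdges (E : Set (Sym2 V))).Adj x y ↔ G.Adj x y ∧ s(x, y) ∉ E :=
    fun x y => by rw [SimpleGraph.deleteEdges_adj, mem_coe]
  generalize G.deleteEdges (E : Set (Sym2 V)) = H at hadj ⊢
  have hn : (0 : ℝ) ≤ μ * Fintype.card V := by positivity
  have hd : ∀ x, (univ.filter fun y => G.Adj x y).card = d := fun x => by
    rw [← hreg x, ← Fintype.card_subtype, ← Nat.card_eq_fintype_card]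
    rfl
  have hsub : ∀ (x : V) (S : Finset V), (S.filter fun y => G.Adj x y).card ≤
      (S.filter fun y => H.Adj x y).card + s := fun x S => by
    refine le_trans ?_ (Nat.add_le_add_left (hE x) _)
    refine le_trans (card_le_card ?_) (card_union_le _ _)
    intro y
    simp only [mem_filter, mem_union, mem_univ, true_and, hadj]
    tauto
  have hdeg : ∀ x, d ≤ (univ.filter fun y =>
      H.Adj x y).card + s := fun x => hd x ▸ hsub x univ
  have hdeg' : ∀ x, (d : ℝ) ≤ (univ.filter fun y =>
      H.Adj x y).card + s := fun x => by exact_mod_cast hdeg x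
  refine ⟨fun x => ?_, hdeg, fun x => ?_, fun S hS => ?_⟩
  · rw [← hd x]
    refine card_le_card fun y => ?_
    simp only [mem_filter, mem_univ, true_and, hadj]
    tauto
  · linarith [hdeg' x]
  · by_cases hS' : (S.card : ℝ) ≤ (1 - τ) * Fintype.card V
    · refine (min_le_right _ _).trans ?_
      have h := hexp (S : Set V) (by simpa using hS) (by simpa using hS')
      have hRN : (Nat.card (RN G ν (S : Set V)) : ℝ) ≤ ((univ.filter fun y =>
          μ * Fintype.card V ≤ ((S.filter fun w =>
            H.Adj w y).card : ℝ)).card : ℝ) := by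
        rw [Nat.card_eq_fintype_card, ← Set.toFinset_card, Nat.cast_le]
        refine card_le_card fun y hy => ?_
        rw [Set.mem_toFinset] at hy
        have hy' : ν * Fintype.card V ≤ ((S.filter fun w => G.Adj y w).card : ℝ) := by
          refine le_trans hy (le_of_eq ?_)
          rw [Nat.card_eq_fintype_card, ← Set.toFinset_card]
          congr 2
          ext w
          simp
        have h2 : ((S.filter fun w => G.Adj y w).card : ℝ) ≤ (S.filter fun w =>
            H.Adj y w).card + s := by exact_mod_cast hsub y S
        simp only [mem_filter, mem_univ, true_and]
        simp only [SimpleGraph.adj_comm _ _ y]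
        linarith
      have hc : (Nat.card (S : Set V) : ℝ) = S.card := by simp
      rw [hc] at h
      have : (0 : ℝ) ≤ s := by positivity
      linarith
    · refine (min_le_left _ _).trans (le_of_eq ?_)
      rw [filter_true_of_mem, card_univ]
      intro y _
      have h1 : (univ.filter fun w => H.Adj y w).card ≤
          (S.filter fun w => H.Adj y w).card + Sᶜ.card := by
        refine le_trans (card_le_card ?_) (card_union_le _ _)
        intro w
        simp only [mem_filter, mem_union, mem_univ, true_and, mem_compl]
        tauto
      have h2 : (Sᶜ.card : ℝ) + S.card = Fintype.card V := by
        exact_mod_cast card_compl_add_card S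
      have h3 : ((univ.filter fun w => H.Adj y w).card : ℝ) ≤
          (S.filter fun w => H.Adj y w).card + Sᶜ.card := by
        exact_mod_cast h1
      simp only [SimpleGraph.adj_comm _ _ y]
      linarith [hdeg' y]

theorem pmCount_deleteEdges {G : SimpleGraph V} {d s k j : ℕ} {μ τ κ : ℝ} (hd : 0 < d)
    (hdn : d ≤ Fintype.card V) (h : SmallError (Fintype.card V) d s k j μ κ)
    {E : Finset (Sym2 V)} (hEG : ∀ e ∈ E, e ∈ G.edgeSet)
    (hE : ∀ F ⊆ E, AlmostRegularExpander (G.deleteEdges (F : Set (Sym2 V))) d s μ τ) :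
    pmCount (G.deleteEdges (E : Set (Sym2 V))) * Real.exp (E.card * ((1 - 4 * κ) / d)) ≤
      pmCount G ∧
    (pmCount G : ℝ) ≤
      pmCount (G.deleteEdges (E : Set (Sym2 V))) * Real.exp (E.card * ((1 + 4 * κ) / d)) := by
  induction E using Finset.induction_on with
  | empty => simp
  | insert e F he ih =>
    obtain ⟨h1, h2⟩ := ih (fun e he => hEG e (mem_insert_of_mem he))
      fun F' hF' => hE F' (hF'.trans (subset_insert _ _))
    obtain ⟨h3, h4⟩ := (hE F (subset_insert _ _)).pmCount_deleteEdge hd hdn h (e := e) (by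
      rw [SimpleGraph.edgeSet_deleteEdges]
      exact ⟨hEG e (mem_insert_self _ _), by simpa using he⟩)
    rw [SimpleGraph.deleteEdges_deleteEdges, Set.union_singleton, ← coe_insert] at h3 h4
    rw [card_insert_of_notMem he, Nat.cast_add, Nat.cast_one, add_mul, add_mul, one_mul, one_mul,
      add_comm, Real.exp_add, ← mul_assoc, add_comm _ ((1 + 4 * κ) / d), Real.exp_add, ← mul_assoc]
    exact ⟨(mul_le_mul_of_nonneg_right h3 (Real.exp_pos _).le).trans h1,
      h2.trans (mul_le_mul_of_nonneg_right h4 (Real.exp_pos _).le)⟩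

/-- The `i`-tuples of pairwise disjoint perfect matchings of `G`. -/
abbrev DisjointPMs (G : SimpleGraph V) (i : ℕ) : Type _ :=
  {f : Fin i → Finset (Sym2 V) // (∀ a, IsPM G (f a)) ∧ ∀ a b, a ≠ b → ∀ e ∈ f a, e ∉ f b}

/-- All edges of a tuple of matchings. -/
noncomputable def tupleEdges {i : ℕ} (f : Fin i → Finset (Sym2 V)) : Finset (Sym2 V) :=
  univ.biUnion f

theorem IsPM.card_mul_two {G : SimpleGraph V} {M : Finset (Sym2 V)} (hM : IsPM G M) :
    M.card * 2 = Fintype.card V := by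
  have h := sum_card_bipartiteAbove_eq_sum_card_bipartiteBelow (s := M) (t := univ)
    (fun (e : Sym2 V) (v : V) => v ∈ e)
  have h1 : ∀ e ∈ M, (bipartiteAbove (fun (e : Sym2 V) (v : V) => v ∈ e) univ e).card = 2 :=
    fun e he => by
      rw [← Sym2.card_toFinset_of_not_isDiag e (G.not_isDiag_of_mem_edgeSet (hM.1 e he))]
      congr 1
      ext v
      simp [bipartiteAbove]
  have h2 : ∀ v ∈ (univ : Finset V),
      (bipartiteBelow (fun (e : Sym2 V) (v : V) => v ∈ e) M v).card = 1 := fun v _ => by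
    obtain ⟨e, ⟨he, hv⟩, hu⟩ := hM.2 v
    rw [card_eq_one]
    refine ⟨e, ?_⟩
    ext e'
    simp only [bipartiteBelow, mem_filter, mem_singleton]
    exact ⟨hu e', fun h => h ▸ ⟨he, hv⟩⟩
  rw [sum_congr rfl h1, sum_congr rfl h2] at h
  simpa using h

theorem DisjointPMs.card_tupleEdges {G : SimpleGraph V} {i : ℕ} (f : DisjointPMs G i) :
    ((tupleEdges f.1).card : ℝ) = i * (Fintype.card V / 2) := by
  have h : (tupleEdges f.1).card = ∑ a, (f.1 a).card :=
    card_biUnion fun a _ b _ hab => Finset.disjoint_left.2 fun e => f.2.2 a b hab e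
  have h2 : (tupleEdges f.1).card * 2 = i * Fintype.card V := by
    rw [h, sum_mul, sum_congr rfl fun a _ => (f.2.1 a).card_mul_two]
    simp
  have h3 : ((tupleEdges f.1).card : ℝ) * 2 = i * Fintype.card V := by exact_mod_cast h2
  linarith

theorem DisjointPMs.degree_tupleEdges_le {G : SimpleGraph V} {i : ℕ} (f : DisjointPMs G i)
    (x : V) : (univ.filter fun y => s(x, y) ∈ tupleEdges f.1).card ≤ i := by
  have h : (univ.filter fun y => s(x, y) ∈ tupleEdges f.1) ⊆
      univ.biUnion fun a => univ.filter fun y => s(x, y) ∈ f.1 a := fun y => by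
    simp [tupleEdges]
  refine (card_le_card h).trans ((card_biUnion_le_card_mul _ _ 1 fun a _ => ?_).trans (by simp))
  refine card_le_one.2 fun y hy z hz => ?_
  simp only [mem_filter, mem_univ, true_and] at hy hz
  exact Sym2.congr_right.1 (((f.2.1 a).2 x).unique ⟨hy, by simp⟩ ⟨hz, by simp⟩)

theorem card_disjointPMs_succ (G : SimpleGraph V) (i : ℕ) :
    Nat.card (DisjointPMs G (i + 1)) =
      ∑ f : DisjointPMs G i, pmCount (G.deleteEdges (tupleEdges f.1 : Set (Sym2 V))) := by
  unfold pmCount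
  rw [← Nat.card_sigma]
  refine Nat.card_congr
    { toFun := fun f => ⟨⟨fun a => f.1 a.castSucc, fun a => f.2.1 _, fun a b hab =>
          f.2.2 _ _ fun h => hab (Fin.castSucc_injective _ h)⟩, f.1 (Fin.last i), ?_⟩
      invFun := fun p => ⟨Fin.snoc (α := fun _ => Finset (Sym2 V)) p.1.1 p.2.1, ?_, ?_⟩
      left_inv := fun f => Subtype.ext (Fin.snoc_init_self f.1)
      right_inv := ?_ }
  · refine isPM_deleteEdges.2 ⟨f.2.1 _, fun e he h => ?_⟩
    simp only [tupleEdges, coe_biUnion, Set.mem_iUnion, mem_coe] at h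
    obtain ⟨a, -, ha⟩ := h
    exact f.2.2 _ _ (Fin.castSucc_lt_last a).ne e ha he
  · intro a
    induction a using Fin.lastCases with
    | last => simpa using (isPM_deleteEdges.1 p.2.2).1
    | cast a => simpa using p.1.2.1 a
  · have hlast : ∀ a, ∀ e ∈ p.2.1, e ∉ p.1.1 a := fun a e he h =>
      (isPM_deleteEdges.1 p.2.2).2 e he (by
        simp only [tupleEdges, coe_biUnion, Set.mem_iUnion, mem_coe]
        exact ⟨a, by simp, h⟩)
    intro a b
    induction a using Fin.lastCases with
    | last =>
      induction b using Fin.lastCases with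
      | last => simp
      | cast b => simpa using fun _ => hlast b
    | cast a =>
      induction b using Fin.lastCases with
      | last => simpa using fun e h h' => hlast a e h' h
      | cast b => simpa using fun h => p.1.2.2 a b h
  · rintro ⟨⟨f, hf⟩, M, hM⟩
    exact Sigma.subtype_ext (Subtype.ext (by simp)) (by simp)

theorem card_disjointPMs {G : SimpleGraph V} {d r k j : ℕ} {ν μ τ κ : ℝ} (hd : 0 < d)
    (hdn : d ≤ Fintype.card V) (hexp : RobustExpander G ν τ) (hreg : RegularDeg G d)
    (h : SmallError (Fintype.card V) d r k j μ κ)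
    (hs : μ * Fintype.card V + r ≤ ν * Fintype.card V)
    (hτ : τ * Fintype.card V + μ * Fintype.card V + r ≤ d) {i : ℕ} (hi : i ≤ r) :
    Nat.card (DisjointPMs G i) *
        Real.exp (i.choose 2 * (Fintype.card V / 2) * ((1 - 4 * κ) / d)) ≤ (pmCount G : ℝ) ^ i ∧
    (pmCount G : ℝ) ^ i ≤ Nat.card (DisjointPMs G i) *
        Real.exp (i.choose 2 * (Fintype.card V / 2) * ((1 + 4 * κ) / d)) := by
  induction i with
  | zero =>
    have : Nat.card (DisjointPMs G 0) = 1 := by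
      rw [Nat.card_eq_one_iff_unique]
      exact ⟨inferInstance, ⟨⟨Fin.elim0, fun a => a.elim0, fun a => a.elim0⟩⟩⟩
    rw [this]
    simp
  | succ i ih =>
    obtain ⟨h1, h2⟩ := ih (by lia)
    have key : ∀ f : DisjointPMs G i, _ := fun f =>
      pmCount_deleteEdges (E := tupleEdges f.1) (G := G) (τ := τ) hd hdn h
        (fun e he => by
          obtain ⟨a, -, ha⟩ := mem_biUnion.1 he
          exact (f.2.1 a).1 e ha)
        fun F hF => hexp.deleteEdges hreg (fun x => le_trans
          (card_le_card (monotone_filter_right _ fun y _ hy => hF hy))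
          ((f.degree_tupleEdges_le x).trans (by lia))) h.nu_pos.le hs hτ
    have hsum : (Nat.card (DisjointPMs G (i + 1)) : ℝ) =
        ∑ f : DisjointPMs G i, (pmCount (G.deleteEdges (tupleEdges f.1 : Set (Sym2 V))) : ℝ) := by
      rw [card_disjointPMs_succ]
      push_cast
      rfl
    have hchoose : ((i + 1).choose 2 : ℝ) = i + i.choose 2 := by
      rw [Nat.choose_succ_succ' i 1]
      simp
    have hpm : (0 : ℝ) ≤ pmCount G := by positivity
    rw [hchoose, add_mul, add_mul, add_mul, Real.exp_add, Real.exp_add, hsum, ← mul_assoc,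
      ← mul_assoc, pow_succ]
    have e1 : ∑ f : DisjointPMs G i,
        (pmCount (G.deleteEdges (tupleEdges f.1 : Set (Sym2 V))) : ℝ) *
          Real.exp (i * (Fintype.card V / 2) * ((1 - 4 * κ) / d)) ≤
        Nat.card (DisjointPMs G i) * pmCount G := by
      refine (sum_le_card_nsmul univ _ (pmCount G : ℝ) fun f _ => ?_).trans_eq (by
        rw [nsmul_eq_mul, card_univ, Nat.card_eq_fintype_card])
      rw [← f.card_tupleEdges]
      exact (key f).1
    have e2 : Nat.card (DisjointPMs G i) * pmCount G ≤ ∑ f : DisjointPMs G i,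
        (pmCount (G.deleteEdges (tupleEdges f.1 : Set (Sym2 V))) : ℝ) *
          Real.exp (i * (Fintype.card V / 2) * ((1 + 4 * κ) / d)) := by
      refine Eq.trans_le (by rw [nsmul_eq_mul, card_univ, Nat.card_eq_fintype_card])
        (card_nsmul_le_sum univ _ (pmCount G : ℝ) fun f _ => ?_)
      rw [← f.card_tupleEdges]
      exact (key f).2
    rw [← sum_mul] at e1 e2
    constructor
    · calc _ ≤ (Nat.card (DisjointPMs G i) * pmCount G : ℝ) *
            Real.exp (i.choose 2 * (Fintype.card V / 2) * ((1 - 4 * κ) / d)) :=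
              mul_le_mul_of_nonneg_right e1 (Real.exp_pos _).le
        _ = (Nat.card (DisjointPMs G i) *
            Real.exp (i.choose 2 * (Fintype.card V / 2) * ((1 - 4 * κ) / d))) * pmCount G := by ring
        _ ≤ _ := mul_le_mul_of_nonneg_right h1 hpm
    · calc _ ≤ (Nat.card (DisjointPMs G i) *
            Real.exp (i.choose 2 * (Fintype.card V / 2) * ((1 + 4 * κ) / d))) * pmCount G :=
              mul_le_mul_of_nonneg_right h2 hpm
        _ = (Nat.card (DisjointPMs G i) * pmCount G : ℝ) *
            Real.exp (i.choose 2 * (Fintype.card V / 2) * ((1 + 4 * κ) / d)) := by ring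
        _ ≤ _ := mul_le_mul_of_nonneg_right e2 (Real.exp_pos _).le

end Tuples

section Asymptotics

theorem smallError_of_large {n d s k : ℕ} {δ μ t : ℝ} (hμ : 0 < μ) (hμ1 : μ < 1)
    (hk : 1 ≤ k * μ) (hn : (n : ℝ) = t ^ 50) (hd : δ * n ≤ d) (hs : (s : ℝ) ≤ t)
    (ht : 60 ≤ t) (htδ : 1 ≤ δ * t) (htk : ((k + 1 : ℕ) : ℝ) ≤ t) (htμ : 1 ≤ μ ^ k * t)
    (hexp : t ^ 53 * Real.exp (-t) ≤ 1 / 5) :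
    SmallError n d s k ⌈t ^ 5⌉₊ μ (1 / t ^ 3) := by
  have ht0 : 0 < t := by linarith
  have ht1 : 1 ≤ t := by linarith
  have hd49 : t ^ 49 ≤ d := by
    have : δ * t * t ^ 49 ≤ d := by rw [hn] at hd; linarith
    nlinarith [pow_pos ht0 49]
  have hd0 : (0 : ℝ) < d := lt_of_lt_of_le (by positivity) hd49
  have ha : (s : ℝ) / d ≤ 1 / t ^ 48 := by
    rw [div_le_div_iff₀ hd0 (by positivity)]
    calc (s : ℝ) * t ^ 48 ≤ t * t ^ 48 := by gcongr
      _ = t ^ 49 := by ring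
      _ ≤ 1 * d := by linarith
  have hj0 : 0 < ⌈t ^ 5⌉₊ := Nat.ceil_pos.2 (by positivity)
  have hj : (⌈t ^ 5⌉₊ : ℝ) ≤ 2 * t ^ 5 := by
    have := Nat.ceil_lt_add_one (show 0 ≤ t ^ 5 by positivity)
    have := one_le_pow₀ ht1 (n := 5)
    linarith
  have hc : 0 < μ ^ k := by positivity
  have hc1 : μ ^ k ≤ 1 := pow_le_one₀ hμ.le hμ1.le
  have hsmall : ∀ m : ℕ, 12 / t ^ (m + 4) ≤ 1 / t ^ 3 / 5 := fun m => by
    rw [div_div, div_le_div_iff₀ (by positivity) (by positivity)]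
    have h1 : t ^ 3 * t ≤ t ^ (m + 4) := by
      rw [← pow_succ]
      exact pow_le_pow_right₀ ht1 (by lia)
    nlinarith [pow_pos ht0 3]
  have hkj : (((k + 1) * ⌈t ^ 5⌉₊ : ℕ) : ℝ) ≤ 2 * t ^ 6 := by
    push_cast at htk ⊢
    calc ((k : ℝ) + 1) * ⌈t ^ 5⌉₊ ≤ t * (2 * t ^ 5) := by gcongr
      _ = 2 * t ^ 6 := by ring
  have b1 : ((k + 1 : ℕ) : ℝ) * ⌈t ^ 5⌉₊ * (s / d) ≤ 1 / t ^ 3 / 5 := by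
    refine le_trans ?_ (hsmall 38)
    calc ((k + 1 : ℕ) : ℝ) * ⌈t ^ 5⌉₊ * (s / d) ≤ t * (2 * t ^ 5) * (1 / t ^ 48) := by gcongr
      _ = 2 / t ^ (38 + 4) := by field_simp
      _ ≤ 12 / t ^ (38 + 4) := by gcongr; norm_num
  have b2 : (n : ℝ) * (1 - μ ^ k) ^ ⌈t ^ 5⌉₊ ≤ 1 / t ^ 3 / 5 := by
    have h1 : (1 - μ ^ k) ^ ⌈t ^ 5⌉₊ ≤ Real.exp (-t) := by
      calc (1 - μ ^ k) ^ ⌈t ^ 5⌉₊ ≤ Real.exp (-μ ^ k) ^ ⌈t ^ 5⌉₊ := by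
            gcongr
            linarith [Real.add_one_le_exp (-μ ^ k)]
        _ = Real.exp (-(μ ^ k * ⌈t ^ 5⌉₊)) := by rw [← Real.exp_nat_mul]; congr 1; ring
        _ ≤ Real.exp (-t) := by
            gcongr
            calc t ≤ t ^ 4 := le_self_pow₀ ht1 (by norm_num)
              _ ≤ μ ^ k * t * t ^ 4 := le_mul_of_one_le_left (by positivity) htμ
              _ = μ ^ k * t ^ 5 := by ring
              _ ≤ _ := by gcongr; exact Nat.le_ceil _
    rw [hn, div_div, le_div_iff₀ (by positivity)]
    calc t ^ 50 * (1 - μ ^ k) ^ ⌈t ^ 5⌉₊ * (t ^ 3 * 5) ≤ t ^ 50 * Real.exp (-t) * (t ^ 3 * 5) := by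
          gcongr
      _ = t ^ 53 * Real.exp (-t) * 5 := by ring
      _ ≤ 1 := by linarith
  have b3 : ((k + 1 : ℕ) : ℝ) * (s / d) / μ ^ k ≤ 1 / t ^ 3 / 5 := by
    refine le_trans ?_ (hsmall 42)
    rw [div_le_iff₀ hc]
    calc ((k + 1 : ℕ) : ℝ) * (s / d) ≤ t * (1 / t ^ 48) * 1 := by rw [mul_one]; gcongr
      _ ≤ t * (1 / t ^ 48) * (μ ^ k * t) := by gcongr
      _ = 1 / t ^ (42 + 4) * μ ^ k := by field_simp
      _ ≤ 12 / t ^ (42 + 4) * μ ^ k := by gcongr; norm_num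
  have b4 : (s : ℝ) / d ≤ 1 / t ^ 3 / 5 := by
    refine (ha.trans ?_).trans (hsmall 44)
    gcongr
    norm_num
  have b5 : (((k + 1) * ⌈t ^ 5⌉₊ : ℕ) : ℝ) * (2 * ((k + 1) * ⌈t ^ 5⌉₊ : ℕ) + 2) * n /
      (d : ℝ) ^ 2 ≤ 1 / t ^ 3 / 5 := by
    refine le_trans ?_ (hsmall 32)
    have h1 : 2 * (((k + 1) * ⌈t ^ 5⌉₊ : ℕ) : ℝ) + 2 ≤ 6 * t ^ 6 := by
      have := one_le_pow₀ ht1 (n := 6)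
      linarith
    calc _ ≤ 2 * t ^ 6 * (6 * t ^ 6) * t ^ 50 / (t ^ 49) ^ 2 := by rw [hn]; gcongr
      _ = 12 / t ^ (32 + 4) := by field_simp; ring
  refine ⟨hμ, hk, hj0, ?_, ?_, by linarith⟩
  · gcongr
    exact (pow_le_pow_right₀ ht1 (by norm_num)).trans hd49
  · gcongr
    have := le_self_pow₀ ht1 (n := 3) (by norm_num)
    linarith

theorem div_bounds_of_exp_bounds {N P x y ε : ℝ} (hN : 0 ≤ N) (hP : 0 < P)
    (h₁ : N * Real.exp (x - y) ≤ P) (h₂ : P ≤ N * Real.exp (x + y)) (hy : y ≤ ε)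
    (hy' : Real.exp y ≤ 1 + ε) :
    (1 - ε) * Real.exp (-x) ≤ N / P ∧ N / P ≤ (1 + ε) * Real.exp (-x) := by
  constructor
  · rw [le_div_iff₀ hP]
    have h3 : 1 - ε ≤ Real.exp (-y) := by linarith [Real.add_one_le_exp (-y)]
    calc (1 - ε) * Real.exp (-x) * P ≤ Real.exp (-y) * Real.exp (-x) * (N * Real.exp (x + y)) := by
          gcongr
      _ = N * Real.exp (-y + -x + (x + y)) := by
          rw [Real.exp_add (-y + -x), Real.exp_add (-y)]; ring
      _ = N := by ring_nf; simp
  · rw [div_le_iff₀ hP]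
    calc N = Real.exp y * Real.exp (-x) * (N * Real.exp (x - y)) := by
          rw [mul_left_comm, ← Real.exp_add, ← Real.exp_add]; ring_nf; simp
      _ ≤ (1 + ε) * Real.exp (-x) * P := by
          have := (Real.exp_pos y).le.trans hy'
          gcongr

end Asymptotics

/-- The probability that `r` independent uniformly random perfect
matchings of a `d`-regular robust `(ν,τ)`-expander are pairwise edge-disjoint is
`(1 ± ε) e^{-(n/(2d))·C(r,2)}`. Here the probability is the number of `r`-tuples of
pairwise disjoint perfect matchings divided by `pm(G)^r`. -/
theorem disjoint_random_perfect_matchings :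
    ∀ δ : ℝ, 0 < δ →
    ∃ τ : ℝ, 0 < τ ∧
    ∀ ν : ℝ, 0 < ν →
    ∀ ε : ℝ, 0 < ε →
    ∃ n₀ : ℕ, ∀ n : ℕ, n₀ ≤ n → Even n →
    ∀ d : ℕ, δ * (n : ℝ) ≤ (d : ℝ) →
    ∀ r : ℕ, 1 ≤ r → (r : ℝ) ≤ (n : ℝ) ^ ((1 : ℝ) / 50) →
    ∀ (V : Type) [Fintype V], Fintype.card V = n →
    ∀ G : SimpleGraph V, RegularDeg G d → RobustExpander G ν τ →
    pmCount G ≠ 0 →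
      (1 - ε) * Real.exp (-((n : ℝ) / (2 * (d : ℝ))) * (r.choose 2 : ℝ)) ≤
        (Nat.card {f : Fin r → Finset (Sym2 V) // (∀ i, IsPM G (f i)) ∧
          ∀ i j, i ≠ j → ∀ e ∈ f i, e ∉ f j} : ℝ) / (pmCount G : ℝ) ^ r ∧
      (Nat.card {f : Fin r → Finset (Sym2 V) // (∀ i, IsPM G (f i)) ∧
          ∀ i j, i ≠ j → ∀ e ∈ f i, e ∉ f j} : ℝ) / (pmCount G : ℝ) ^ r ≤
        (1 + ε) * Real.exp (-((n : ℝ) / (2 * (d : ℝ))) * (r.choose 2 : ℝ)) := by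
  intro δ hδ
  refine ⟨δ / 4, by positivity, fun ν hν ε hε => ?_⟩
  obtain ⟨μ, hμ, hμν, hμδ, hμ1⟩ : ∃ μ : ℝ, 0 < μ ∧ μ ≤ ν / 2 ∧ μ ≤ δ / 4 ∧ μ < 1 :=
    ⟨min (ν / 2) (min (δ / 4) (1 / 2)), by positivity, min_le_left _ _,
      (min_le_right _ _).trans (min_le_left _ _),
      ((min_le_right _ _).trans (min_le_right _ _)).trans_lt (by norm_num)⟩
  set k := ⌈1 / μ⌉₊ with hkdef
  have hk : 1 ≤ k * μ := by
    rw [← div_le_iff₀ hμ]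
    exact Nat.le_ceil _
  have hc : 0 < μ ^ k := by positivity
  set L := min ε (Real.log (1 + ε)) with hL
  have hL0 : 0 < L := lt_min hε (Real.log_pos (by linarith))
  have hexpL : Real.exp L ≤ 1 + ε := by
    rw [← Real.le_log_iff_exp_le (by linarith)]
    exact min_le_right _ _
  have hev : ∀ᶠ t : ℝ in Filter.atTop, 60 ≤ t ∧ 4 / δ ≤ t ∧ 2 / ν ≤ t ∧ ((k + 1 : ℕ) : ℝ) ≤ t ∧
      1 / μ ^ k ≤ t ∧ 2 / (δ * L) ≤ t ∧ t ^ 53 * Real.exp (-t) ≤ 1 / 5 := by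
    have h := (Real.tendsto_pow_mul_exp_neg_atTop_nhds_zero 53).eventually_le_const
      (show (0 : ℝ) < 1 / 5 by norm_num)
    filter_upwards [Filter.eventually_ge_atTop 60, Filter.eventually_ge_atTop (4 / δ),
      Filter.eventually_ge_atTop (2 / ν), Filter.eventually_ge_atTop ((k + 1 : ℕ) : ℝ),
      Filter.eventually_ge_atTop (1 / μ ^ k), Filter.eventually_ge_atTop (2 / (δ * L)), h]
      with t h1 h2 h3 h4 h5 h6 h7
    exact ⟨h1, h2, h3, h4, h5, h6, h7⟩
  obtain ⟨n₀, hn₀⟩ := Filter.eventually_atTop.1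
    (((tendsto_rpow_atTop (show (0 : ℝ) < 1 / 50 by norm_num)).comp
      tendsto_natCast_atTop_atTop).eventually hev)
  refine ⟨n₀, fun n hn _ d hd r _ hr V _ hV G hreg hexp hpm => ?_⟩
  obtain ⟨h60, h4δ, h2ν, htk, htμ, htL, hte⟩ := hn₀ n hn
  simp only [Function.comp_apply] at h60 h4δ h2ν htk htμ htL hte
  have hnt : (n : ℝ) = ((n : ℝ) ^ ((1 : ℝ) / 50)) ^ 50 := by
    rw [← Real.rpow_natCast, ← Real.rpow_mul (by positivity)]
    norm_num
  generalize (n : ℝ) ^ ((1 : ℝ) / 50) = t at *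
  have ht0 : 0 < t := by linarith
  have ht1 : 1 ≤ t := by linarith
  rw [div_le_iff₀' (by positivity)] at h4δ h2ν htμ htL
  have htn : t * t ≤ n := by
    rw [hnt, ← sq]
    exact pow_le_pow_right₀ ht1 (by norm_num)
  have hn0 : (0 : ℝ) < n := by rw [hnt]; positivity
  have hd0 : (0 : ℝ) < d := lt_of_lt_of_le (by positivity) hd
  have herr := smallError_of_large hμ hμ1 hk hnt hd hr h60 (by linarith) htk htμ hte
  have hdn : d ≤ Fintype.card V := by
    have : Nonempty V := Fintype.card_pos_iff.1 (by rw [hV]; exact_mod_cast hn0)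
    rw [← hreg (Classical.arbitrary V), ← Nat.card_eq_fintype_card]
    exact Finite.card_subtype_le _
  rw [← hV] at herr
  have hrδ : 4 * (r : ℝ) ≤ δ * n := by nlinarith
  have hrν : 2 * (r : ℝ) ≤ ν * n := by nlinarith
  have main := card_disjointPMs (i := r) (by exact_mod_cast hd0) hdn hexp hreg herr
    (by rw [hV]; nlinarith) (by rw [hV]; nlinarith) le_rfl
  rw [hV] at main
  have hchoose : (r.choose 2 : ℝ) ≤ t ^ 2 := by
    calc (r.choose 2 : ℝ) ≤ (r : ℝ) ^ 2 := by exact_mod_cast Nat.choose_le_pow r 2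
      _ ≤ t ^ 2 := by gcongr
  have hy : 4 * (1 / t ^ 3) * (n / (2 * d) * r.choose 2) ≤ L := by
    have h1 : (n : ℝ) / (2 * d) ≤ 1 / (2 * δ) := by
      rw [div_le_div_iff₀ (by positivity) (by positivity)]
      linarith
    calc 4 * (1 / t ^ 3) * (n / (2 * d) * r.choose 2) ≤ 4 * (1 / t ^ 3) * (1 / (2 * δ) * t ^ 2) := by
          gcongr
      _ = 2 / (δ * t) := by field_simp; ring
      _ ≤ L := by rw [div_le_iff₀ (by positivity)]; linarith
  rw [neg_mul]
  refine div_bounds_of_exp_bounds (y := 4 * (1 / t ^ 3) * (n / (2 * d) * r.choose 2))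
    (by positivity) (by positivity) ?_ ?_ (hy.trans (min_le_left _ _))
    ((Real.exp_le_exp.2 hy).trans hexpL)
  · convert main.1 using 3
    field_simp
  · convert main.2 using 3
    field_simp

end RPM
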